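/- arXiv:math/9909186 — 5 statements merged into one kernel-verified Lean document; each statement's English description precedes it below -/
import Mathlib

section
/- Let V be a finite-dimensional complex inner product space, let φ : V → V be a nonnegative selfadjoint linear operator, and let 0 < a < b. For a nonnegative selfadjoint operator ψ on V write F_ψ(λ) for the number of eigenvalues of ψ, counted with multiplicity, that are strictly less than λ. Then there exists a smooth compactly supported function f : [0,∞) → ℝ such that, setting ψ := φ + f(φ) where f(φ) is defined by the functional calculus (so that f(φ) commutes with φ), the operator ψ is selfadjoint and nonnegative and satisfies: (i) F_ψ(λ) = 0 for all λ ≤ a (in particular ψ is injective); (ii) F_ψ(λ) ≥ F_φ(a) for all λ > a; (iii) F_ψ(λ) = F_φ(λ) for all λ ≥ b. -/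
noncomputable section

/-- The spectral distribution function of a (selfadjoint) operator `ψ` on a
finite-dimensional complex inner product space: the number of eigenvalues of `ψ` that are
`< λ`, counted with multiplicity. -/
def specCount {V : Type} [NormedAddCommGroup V] [InnerProductSpace ℂ V]
    [FiniteDimensional ℂ V] (ψ : V →L[ℂ] V) (lam : ℝ) : ℕ :=
  Module.finrank ℂ
    ↥(⨆ (μ : ℝ) (_ : μ < lam), Module.End.eigenspace (ψ : V →ₗ[ℂ] V) (μ : ℂ))

/-- The functional calculus acts on an eigenvector by evaluation. -/
lemma cfc_apply_eigen {V : Type} [NormedAddCommGroup V] [InnerProductSpace ℂ V]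
    [FiniteDimensional ℂ V] (φ : V →L[ℂ] V) (hφ : IsSelfAdjoint φ) (f : ℝ → ℝ)
    (hf : Differentiable ℝ f) (μ : ℝ) (v : V) (hv : φ v = (μ : ℂ) • v) :
    (cfc f φ) v = ((f μ : ℝ) : ℂ) • v := by
  have hc : Continuous (dslope f μ) := by
    rw [← continuousOn_univ, continuousOn_dslope Filter.univ_mem]
    exact ⟨hf.continuous.continuousOn, hf μ⟩
  have e : f = fun x => f μ + dslope f μ x * (x - μ) := by
    funext x
    have := sub_smul_dslope f μ x
    simp only [smul_eq_mul] at this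
    linarith
  have h1 : cfc f φ = algebraMap ℝ (V →L[ℂ] V) (f μ) +
      cfc (dslope f μ) φ * (φ - algebraMap ℝ (V →L[ℂ] V) μ) := by
    conv_lhs => rw [e]
    rw [cfc_const_add (f μ) (fun x => dslope f μ x * (x - μ)) φ
      ((hc.mul (by fun_prop)).continuousOn),
      cfc_mul (dslope f μ) (fun x => x - μ) φ hc.continuousOn (by fun_prop),
      cfc_sub (fun x => x) (fun _ => μ) φ (by fun_prop) (by fun_prop), cfc_id' ℝ φ,
      cfc_const μ φ]
  have h2 : (φ - algebraMap ℝ (V →L[ℂ] V) μ) v = 0 := by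
    simp [Algebra.algebraMap_eq_smul_one, hv]
  have h3 : (cfc (dslope f μ) φ * (φ - algebraMap ℝ (V →L[ℂ] V) μ)) v = 0 := by
    change (cfc (dslope f μ) φ) ((φ - algebraMap ℝ (V →L[ℂ] V) μ) v) = 0
    rw [h2, map_zero]
  rw [h1, add_apply, h3]
  simp [Algebra.algebraMap_eq_smul_one]

lemma iSup_eigenspace_shift {V : Type} [NormedAddCommGroup V] [InnerProductSpace ℂ V]
    [FiniteDimensional ℂ V] (φ ψ : V →L[ℂ] V) (hφ : IsSelfAdjoint φ) (g : ℝ → ℝ)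
    (h : ∀ (μ : ℝ) (v : V), φ v = (μ : ℂ) • v → ψ v = ((g μ : ℝ) : ℂ) • v) (lam : ℝ) :
    (⨆ (μ : ℝ) (_ : μ < lam), Module.End.eigenspace (ψ : V →ₗ[ℂ] V) (μ : ℂ)) =
    ⨆ (μ : ℝ) (_ : g μ < lam), Module.End.eigenspace (φ : V →ₗ[ℂ] V) (μ : ℂ) := by
  have hle : ∀ μ : ℝ, Module.End.eigenspace (φ : V →ₗ[ℂ] V) (μ : ℂ) ≤
      Module.End.eigenspace (ψ : V →ₗ[ℂ] V) ((g μ : ℝ) : ℂ) := by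
    intro μ v hv
    rw [Module.End.mem_eigenspace_iff] at hv ⊢
    exact h μ v hv
  have hsym : (φ : V →ₗ[ℂ] V).IsSymmetric := hφ.isSymmetric
  have hdisj : Disjoint
      (⨆ (μ : ℝ) (_ : μ < lam), Module.End.eigenspace (ψ : V →ₗ[ℂ] V) (μ : ℂ))
      (⨆ (μ : ℝ) (_ : lam ≤ μ), Module.End.eigenspace (ψ : V →ₗ[ℂ] V) (μ : ℂ)) := by
    have hi := (Module.End.eigenspaces_iSupIndep (ψ : V →ₗ[ℂ] V)).comp Complex.ofReal_injective
    have hs : Disjoint {μ : ℝ | μ < lam} {μ : ℝ | lam ≤ μ} := by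
      rw [Set.disjoint_left]
      intro x hx hy
      simp at hx hy
      linarith
    simpa using hi.disjoint_biSup_biSup hs
  have htop : (⨆ (μ : ℝ), Module.End.eigenspace (φ : V →ₗ[ℂ] V) (μ : ℂ)) = ⊤ := by
    have h0 := hsym.orthogonalComplement_iSup_eigenspaces_eq_bot
    rw [Submodule.orthogonal_eq_bot_iff] at h0
    rw [eq_top_iff, ← h0]
    refine iSup_le fun μ => ?_
    by_cases hb : Module.End.eigenspace (φ : V →ₗ[ℂ] V) μ = ⊥
    · rw [hb]; exact bot_le
    · have hre : (starRingEnd ℂ) μ = μ := hsym.conj_eigenvalue_eq_self hb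
      obtain ⟨r, hr⟩ := Complex.conj_eq_iff_real.1 hre
      rw [hr]
      exact le_iSup (fun μ : ℝ => Module.End.eigenspace (φ : V →ₗ[ℂ] V) (μ : ℂ)) r
  symm
  refine eq_of_le_of_inf_le_of_sup_le
    (z := ⨆ (μ : ℝ) (_ : lam ≤ μ), Module.End.eigenspace (ψ : V →ₗ[ℂ] V) (μ : ℂ)) ?_ ?_ ?_
  · exact iSup₂_le fun μ hμ => (hle μ).trans
      (le_iSup₂ (f := fun (μ : ℝ) (_ : μ < lam) =>
        Module.End.eigenspace (ψ : V →ₗ[ℂ] V) (μ : ℂ)) (g μ) hμ)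
  · rw [hdisj.eq_bot]; exact bot_le
  · refine le_top.trans (htop.symm.le.trans (iSup_le fun μ => ?_))
    rcases lt_or_ge (g μ) lam with hμ | hμ
    · exact le_sup_of_le_left (le_iSup₂ (f := fun (μ : ℝ) (_ : g μ < lam) =>
        Module.End.eigenspace (φ : V →ₗ[ℂ] V) (μ : ℂ)) μ hμ)
    · exact le_sup_of_le_right ((hle μ).trans (le_iSup₂ (f := fun (μ : ℝ) (_ : lam ≤ μ) =>
        Module.End.eigenspace (ψ : V →ₗ[ℂ] V) (μ : ℂ)) (g μ) hμ))

lemma exists_shift_fun (a b : ℝ) (ha : 0 < a) (hab : a < b) :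
    ∃ f : ℝ → ℝ, ContDiff ℝ (⊤ : ℕ∞) f ∧ HasCompactSupport f ∧
      (∀ x, 0 ≤ x → a ≤ x + f x) ∧ (∀ x, 0 ≤ x → x ≤ a → x + f x = a) ∧
      (∀ x, a ≤ x → x + f x ≤ x) ∧ (∀ x, b ≤ x → x + f x = x) := by
  have hba : 0 < b - a := sub_pos.2 hab
  refine ⟨fun x => (1 - Real.smoothTransition ((x - a) / (b - a))) * (a - x) *
    Real.smoothTransition (x + 1), ?_, ?_, ?_, ?_, ?_, ?_⟩
  · refine ((contDiff_const.sub (Real.smoothTransition.contDiff.comp ?_)).mul ?_).mul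
      (Real.smoothTransition.contDiff.comp ?_)
    · exact (contDiff_id.sub contDiff_const).div_const _
    · exact contDiff_const.sub contDiff_id
    · exact contDiff_id.add contDiff_const
  · refine HasCompactSupport.intro (isCompact_Icc (a := (-1 : ℝ)) (b := b)) fun x hx => ?_
    rw [Set.mem_Icc, not_and_or, not_le, not_le] at hx
    rcases hx with hx | hx
    · simp [Real.smoothTransition.zero_of_nonpos (show x + 1 ≤ 0 by linarith)]
    · simp [Real.smoothTransition.one_of_one_le
        (show 1 ≤ (x - a) / (b - a) by rw [le_div_iff₀ hba]; linarith)]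
  · intro x hx
    simp only [Real.smoothTransition.one_of_one_le (show 1 ≤ x + 1 by linarith), mul_one]
    rcases le_total x a with h | h
    · simp [Real.smoothTransition.zero_of_nonpos
        (div_nonpos_of_nonpos_of_nonneg (show x - a ≤ 0 by linarith) hba.le)]
    · nlinarith [Real.smoothTransition.nonneg ((x - a) / (b - a))]
  · intro x hx h
    simp [Real.smoothTransition.one_of_one_le (show 1 ≤ x + 1 by linarith),
      Real.smoothTransition.zero_of_nonpos
        (div_nonpos_of_nonpos_of_nonneg (show x - a ≤ 0 by linarith) hba.le)]
  · intro x h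
    simp only [Real.smoothTransition.one_of_one_le (show 1 ≤ x + 1 by linarith), mul_one]
    nlinarith [Real.smoothTransition.le_one ((x - a) / (b - a))]
  · intro x h
    simp [Real.smoothTransition.one_of_one_le
        (show 1 ≤ (x - a) / (b - a) by rw [le_div_iff₀ hba]; linarith)]

/-- **Lemma 1.4 of [BFK, "Relative torsion"]** (finite-dimensional case `𝒜 = ℂ`).
Given a nonnegative selfadjoint operator `φ` on a finite-dimensional complex inner product
space and `0 < a < b`, there is a smooth compactly supported `f : ℝ → ℝ` such that
`ψ := φ + f(φ)` (with `f(φ)` given by the functional calculus, hence commuting with `φ`)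
is nonnegative selfadjoint and satisfies: (i) `F_ψ(λ) = 0` for `λ ≤ a` (in particular `ψ`
is injective); (ii) `F_ψ(λ) ≥ F_φ(a)` for `λ > a`; (iii) `F_ψ(λ) = F_φ(λ)` for `λ ≥ b`. -/
theorem exists_smooth_spectral_shift {V : Type} [NormedAddCommGroup V]
    [InnerProductSpace ℂ V] [FiniteDimensional ℂ V]
    (φ : V →L[ℂ] V) (hφ : φ.IsPositive) (a b : ℝ) (ha : 0 < a) (hab : a < b) :
    ∃ f : ℝ → ℝ, ContDiff ℝ (⊤ : ℕ∞) f ∧ HasCompactSupport f ∧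
      Commute φ (cfc f φ) ∧
      (φ + cfc f φ).IsPositive ∧
      (∀ lam : ℝ, lam ≤ a → specCount (φ + cfc f φ) lam = 0) ∧
      Function.Injective (φ + cfc f φ) ∧
      (∀ lam : ℝ, a < lam → specCount φ a ≤ specCount (φ + cfc f φ) lam) ∧
      (∀ lam : ℝ, b ≤ lam → specCount (φ + cfc f φ) lam = specCount φ lam) := by
  obtain ⟨f, hf, hfc, h1, h2, h3, h4⟩ := exists_shift_fun a b ha hab
  have hsa : IsSelfAdjoint φ := hφ.isSelfAdjoint
  have hpos : (0 : V →L[ℂ] V) ≤ φ := (ContinuousLinearMap.nonneg_iff_isPositive φ).2 hφ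
  have hE := iSup_eigenspace_shift φ (φ + cfc f φ) hsa (fun x => x + f x) (by
    intro μ v hv
    rw [add_apply, hv,
      cfc_apply_eigen φ hsa f (hf.differentiable (by simp)) μ v hv]
    push_cast
    rw [add_smul])
  have hneg : ∀ μ : ℝ, μ < 0 → Module.End.eigenspace (φ : V →ₗ[ℂ] V) (μ : ℂ) = ⊥ := by
    intro μ hμ
    rw [Submodule.eq_bot_iff]
    intro v hv
    rw [Module.End.mem_eigenspace_iff] at hv
    have hv' : φ v = (μ : ℂ) • v := hv
    have h := hφ.re_inner_nonneg_right v
    rw [hv', inner_smul_right, inner_self_eq_norm_sq_to_K] at h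
    have h' : 0 ≤ μ * ‖v‖ ^ 2 := by
      have e : ((μ : ℂ) * (‖v‖ : ℂ) ^ 2) = ((μ * ‖v‖ ^ 2 : ℝ) : ℂ) := by push_cast; rfl
      erw [e] at h
      exact h
    by_contra hne
    have : 0 < ‖v‖ ^ 2 := by positivity
    nlinarith
  have hbot : ∀ lam : ℝ, lam ≤ a →
      (⨆ (μ : ℝ) (_ : μ < lam),
        Module.End.eigenspace ((φ + cfc f φ : V →L[ℂ] V) : V →ₗ[ℂ] V) (μ : ℂ)) = ⊥ := by
    intro lam hl
    rw [hE, eq_bot_iff]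
    refine iSup₂_le fun μ hμ => ?_
    rcases lt_or_ge μ 0 with h | h
    · exact (hneg μ h).le
    · have := h1 μ h
      linarith
  refine ⟨f, hf, hfc, (cfc_commute_cfc id f φ |> fun h => by rwa [cfc_id ℝ φ] at h), ?_, ?_, ?_,
    ?_, ?_⟩
  · rw [← ContinuousLinearMap.nonneg_iff_isPositive]
    have e : φ + cfc f φ = cfc (fun x => x + f x) φ := by
      rw [cfc_add φ (fun x => x) f (by fun_prop) hf.continuous.continuousOn, cfc_id' ℝ φ]
    rw [e]
    exact cfc_nonneg fun x hx => ha.le.trans (h1 x (spectrum_nonneg_of_nonneg hpos hx))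
  · intro lam hl
    rw [specCount, hbot lam hl, finrank_bot]
  · rw [injective_iff_map_eq_zero]
    intro v hv
    have hm : v ∈ (⨆ (μ : ℝ) (_ : μ < a),
        Module.End.eigenspace ((φ + cfc f φ : V →L[ℂ] V) : V →ₗ[ℂ] V) (μ : ℂ)) := by
      refine (le_iSup₂ (f := fun (μ : ℝ) (_ : μ < a) =>
        Module.End.eigenspace ((φ + cfc f φ : V →L[ℂ] V) : V →ₗ[ℂ] V) (μ : ℂ)) 0 ha) ?_
      rw [Module.End.mem_eigenspace_iff]
      simpa using hv
    rw [hbot a le_rfl] at hm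
    simpa using hm
  · intro lam hl
    rw [specCount, specCount, hE]
    refine Submodule.finrank_mono (iSup₂_le fun μ hμ => ?_)
    rcases lt_or_ge μ 0 with h | h
    · rw [hneg μ h]; exact bot_le
    · exact le_iSup₂ (f := fun (μ : ℝ) (_ : μ + f μ < lam) =>
        Module.End.eigenspace (φ : V →ₗ[ℂ] V) (μ : ℂ)) μ (by rw [h2 μ h hμ.le]; exact hl)
  · intro lam hl
    rw [specCount, specCount, hE]
    refine congrArg (fun W : Submodule ℂ V => Module.finrank ℂ W) (iSup_congr fun μ => ?_)
    rcases lt_or_ge μ 0 with h | h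
    · simp [hneg μ h]
    · have : μ + f μ < lam ↔ μ < lam := by
        rcases lt_or_ge μ b with hb | hb
        · rcases le_total μ a with h' | h'
          · rw [h2 μ h h']; constructor <;> intro <;> linarith
          · have := h3 μ h'; constructor <;> intro <;> linarith
        · rw [h4 μ hb]
      simp only [this]
end
end

section
/- Let (C, d) be a cochain complex of finite-dimensional complex inner product spaces and let id : C → C be the identity morphism. Then the mapping cone C(id) is an acyclic cochain complex of finite-dimensional complex inner product spaces and T(C(id)) = 1. -/
noncomputable section

open LinearMap

/-- A cochain complex of finite-dimensional complex inner product spaces,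
supported in degrees `0, …, N` (the spaces in degrees `> N` are trivial). -/
structure FinComplex (N : ℕ) where
  /-- the spaces of the complex -/
  C : ℕ → Type
  [normed : ∀ q, NormedAddCommGroup (C q)]
  [ipspace : ∀ q, InnerProductSpace ℂ (C q)]
  [findim : ∀ q, FiniteDimensional ℂ (C q)]
  /-- the differentials -/
  d : ∀ q, C q →ₗ[ℂ] C (q + 1)
  dd : ∀ q, (d (q + 1)).comp (d q) = 0
  trivial_beyond : ∀ q, N < q → ∀ x : C q, x = 0

attribute [instance] FinComplex.normed FinComplex.ipspace FinComplex.findim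

namespace FinComplex

variable {N : ℕ}

/-- The Laplacians `Δ_q = d_q^* d_q + d_{q-1} d_{q-1}^*` (no second term for `q = 0`). -/
def lap (X : FinComplex N) : ∀ q, X.C q →ₗ[ℂ] X.C q
  | 0 => (LinearMap.adjoint (X.d 0)).comp (X.d 0)
  | (q + 1) =>
      (LinearMap.adjoint (X.d (q + 1))).comp (X.d (q + 1)) +
        (X.d q).comp (LinearMap.adjoint (X.d q))

/-- Acyclicity: `ker d_q = range d_{q-1}` for every `q` (for `q = 0` this reads `ker d_0 = 0`). -/
def Acyclic (X : FinComplex N) : Prop :=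
  LinearMap.ker (X.d 0) = ⊥ ∧
    ∀ q, LinearMap.ker (X.d (q + 1)) = LinearMap.range (X.d q)

/-- `log T(C) = (1/2) * Σ_q (-1)^(q+1) * q * log det Δ_q`. -/
def logT (X : FinComplex N) : ℝ :=
  (1 / 2) * ∑ q ∈ Finset.range (N + 1),
      (-1 : ℝ) ^ (q + 1) * (q : ℝ) * Real.log ((LinearMap.det (X.lap q)).re)

/-- Morphism of cochain complexes. -/
def IsMorphism (X Y : FinComplex N) (f : ∀ q, X.C q →ₗ[ℂ] Y.C q) : Prop :=
  ∀ q x, f (q + 1) (X.d q x) = Y.d q (f q x)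

/-- `f` induces an isomorphism in cohomology
(`ker d_q / range d_{q-1} → ker d'_q / range d'_{q-1}` is bijective for all `q`). -/
def InducesCohomologyIso (X Y : FinComplex N) (f : ∀ q, X.C q →ₗ[ℂ] Y.C q) : Prop :=
  (∀ x : X.C 0, X.d 0 x = 0 → f 0 x = 0 → x = 0) ∧
  (∀ y : Y.C 0, Y.d 0 y = 0 → ∃ x : X.C 0, X.d 0 x = 0 ∧ f 0 x = y) ∧
  (∀ q, ∀ x : X.C (q + 1), X.d (q + 1) x = 0 →
      (∃ v, Y.d q v = f (q + 1) x) → ∃ u, X.d q u = x) ∧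
  (∀ q, ∀ y : Y.C (q + 1), Y.d (q + 1) y = 0 →
      ∃ x : X.C (q + 1), X.d (q + 1) x = 0 ∧ ∃ v, y - f (q + 1) x = Y.d q v)

/-- Data identifying `Z` with the mapping cone of `f : X → Y`:
`Z_k = Y_{k-1} ⊕ X_k` (orthogonal direct sum) with differential
`d(f)_k (v, u) = (-d_Y v + f u, d_X u)`. -/
structure ConeIso (X Y : FinComplex N) (f : ∀ q, X.C q →ₗ[ℂ] Y.C q)
    (Z : FinComplex (N + 1)) where
  e0 : X.C 0 ≃ₗᵢ[ℂ] Z.C 0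
  e : ∀ q, WithLp 2 (Y.C q × X.C (q + 1)) ≃ₗᵢ[ℂ] Z.C (q + 1)
  compat0 : ∀ u : X.C 0,
    Z.d 0 (e0 u) = e 0 ((WithLp.equiv 2 (Y.C 0 × X.C 1)).symm (f 0 u, X.d 0 u))
  compat : ∀ q (v : Y.C q) (u : X.C (q + 1)),
    Z.d (q + 1) (e q ((WithLp.equiv 2 (Y.C q × X.C (q + 1))).symm (v, u))) =
      e (q + 1) ((WithLp.equiv 2 (Y.C (q + 1) × X.C (q + 2))).symm
        (-(Y.d q v) + f (q + 1) u, X.d (q + 1) u))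

end FinComplex

/-- `log vol(g) = (1/2) log det (g^* g)` for a linear map between finite-dimensional
complex inner product spaces. -/
def logvol {E F : Type} [NormedAddCommGroup E] [InnerProductSpace ℂ E] [FiniteDimensional ℂ E]
    [NormedAddCommGroup F] [InnerProductSpace ℂ F] [FiniteDimensional ℂ F]
    (g : E →ₗ[ℂ] F) : ℝ :=
  (1 / 2) * Real.log ((LinearMap.det ((LinearMap.adjoint g).comp g)).re)

section Helpers

variable {E F : Type} [NormedAddCommGroup E] [InnerProductSpace ℂ E] [FiniteDimensional ℂ E]
    [NormedAddCommGroup F] [InnerProductSpace ℂ F] [FiniteDimensional ℂ F]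

open scoped ComplexOrder in
/-- `det (1 + g^* g)` is a positive real number. -/
lemma det_one_add_pos (g : E →ₗ[ℂ] F) :
    ∃ r : ℝ, 0 < r ∧ LinearMap.det (1 + (LinearMap.adjoint g).comp g) = (r : ℂ) := by
  classical
  let b := stdOrthonormalBasis ℂ E
  let c := stdOrthonormalBasis ℂ F
  let A := LinearMap.toMatrix b.toBasis c.toBasis g
  have h : LinearMap.det (1 + (LinearMap.adjoint g).comp g) = (1 + A.conjTranspose * A).det := by
    rw [← LinearMap.det_toMatrix b.toBasis, map_add, LinearMap.toMatrix_one,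
      LinearMap.toMatrix_comp b.toBasis c.toBasis b.toBasis, LinearMap.toMatrix_adjoint b c]
  have hp : (0 : ℂ) < (1 + A.conjTranspose * A).det := by
    exact (Matrix.PosDef.one.add_posSemidef (Matrix.posSemidef_conjTranspose_mul_self A)).det_pos
  rw [Complex.lt_def] at hp
  refine ⟨((1 + A.conjTranspose * A).det).re, hp.1, ?_⟩
  rw [h]
  apply Complex.ext
  · simp
  · simpa using hp.2.symm

/-- Weinstein–Aronszajn for linear maps. -/
lemma det_one_add_comm (g : E →ₗ[ℂ] F) :
    LinearMap.det (1 + g.comp (LinearMap.adjoint g)) =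
      LinearMap.det (1 + (LinearMap.adjoint g).comp g) := by
  classical
  let b := (stdOrthonormalBasis ℂ E).toBasis
  let c := (stdOrthonormalBasis ℂ F).toBasis
  rw [← LinearMap.det_toMatrix b, ← LinearMap.det_toMatrix c, map_add, map_add,
    LinearMap.toMatrix_one, LinearMap.toMatrix_one, LinearMap.toMatrix_comp b c b,
    LinearMap.toMatrix_comp c b c, Matrix.det_one_add_mul_comm]

/-- `log det (1 + g^* g)`. -/
def ldet (g : E →ₗ[ℂ] F) : ℝ :=
  Real.log (LinearMap.det (1 + (LinearMap.adjoint g).comp g)).re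

lemma det_eq_exp_ldet (g : E →ₗ[ℂ] F) :
    LinearMap.det (1 + (LinearMap.adjoint g).comp g) = ((Real.exp (ldet g) : ℝ) : ℂ) := by
  obtain ⟨r, hr, h⟩ := det_one_add_pos g
  rw [ldet, h, Complex.ofReal_re, Real.exp_log hr]

end Helpers

namespace FinComplex

variable {N : ℕ}

/-- the shifted sequence of `log det (1 + d^* d)`. -/
def gam (X : FinComplex N) : ℕ → ℝ
  | 0 => 0
  | (q + 1) => ldet (X.d q)

lemma gam_beyond (X : FinComplex N) (q : ℕ) (hq : N ≤ q) : X.gam (q + 1) = 0 := by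
  have h : X.d q = 0 := by
    ext x
    exact X.trivial_beyond _ (by omega) _
  simp [gam, ldet, h]

lemma det_one_add_lap (X : FinComplex N) (q : ℕ) :
    LinearMap.det (1 + X.lap q) = ((Real.exp (X.gam q + X.gam (q + 1)) : ℝ) : ℂ) := by
  cases q with
  | zero => simp only [lap, gam, det_eq_exp_ldet, zero_add]
  | succ q =>
    have h : (1 + X.lap (q + 1)) =
        (1 + (LinearMap.adjoint (X.d (q + 1))).comp (X.d (q + 1))) *
          (1 + (X.d q).comp (LinearMap.adjoint (X.d q))) := by
      ext x
      have := LinearMap.congr_fun (X.dd q) (LinearMap.adjoint (X.d q) x)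
      simp only [LinearMap.comp_apply, LinearMap.zero_apply] at this
      simp [lap, this, add_assoc, add_comm]
    rw [h, map_mul, det_one_add_comm, det_eq_exp_ldet, det_eq_exp_ldet]
    simp only [gam]
    rw [Real.exp_add]
    push_cast
    ring

section Cone

variable {X : FinComplex N} {Z : FinComplex (N + 1)}


/-- the underlying linear equivalence -/
def coneE (hZ : ConeIso X X (fun _ => LinearMap.id) Z) (q : ℕ) :
    (X.C q × X.C (q + 1)) ≃ₗ[ℂ] Z.C (q + 1) :=
  (WithLp.linearEquiv 2 ℂ (X.C q × X.C (q + 1))).symm.trans (hZ.e q).toLinearEquiv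

lemma inner_coneE (hZ : ConeIso X X (fun _ => LinearMap.id) Z) (q : ℕ) (a b : X.C q × X.C (q + 1)) :
    inner ℂ (coneE hZ q a) (coneE hZ q b) = inner ℂ a.1 b.1 + inner ℂ a.2 b.2 := by
  change inner ℂ (hZ.e q (WithLp.toLp 2 a)) (hZ.e q (WithLp.toLp 2 b)) = _
  rw [LinearIsometryEquiv.inner_map_map, WithLp.prod_inner_apply]

lemma d_zero (hZ : ConeIso X X (fun _ => LinearMap.id) Z) (u : X.C 0) : Z.d 0 (hZ.e0 u) = coneE hZ 0 (u, X.d 0 u) := hZ.compat0 u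

lemma d_succ (hZ : ConeIso X X (fun _ => LinearMap.id) Z) (q : ℕ) (v : X.C q) (u : X.C (q + 1)) :
    Z.d (q + 1) (coneE hZ q (v, u)) = coneE hZ (q + 1) (-(X.d q v) + u, X.d (q + 1) u) :=
  hZ.compat q v u

lemma adj_zero (hZ : ConeIso X X (fun _ => LinearMap.id) Z) (v : X.C 0) (u : X.C 1) :
    LinearMap.adjoint (Z.d 0) (coneE hZ 0 (v, u)) =
      hZ.e0 (v + LinearMap.adjoint (X.d 0) u) := by
  refine ext_inner_right ℂ fun w => ?_
  obtain ⟨w, rfl⟩ := hZ.e0.surjective w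
  rw [LinearMap.adjoint_inner_left, d_zero, inner_coneE, LinearIsometryEquiv.inner_map_map,
    inner_add_left, LinearMap.adjoint_inner_left]

lemma adj_succ (hZ : ConeIso X X (fun _ => LinearMap.id) Z) (q : ℕ) (v : X.C (q + 1)) (u : X.C (q + 2)) :
    LinearMap.adjoint (Z.d (q + 1)) (coneE hZ (q + 1) (v, u)) =
      coneE hZ q (-(LinearMap.adjoint (X.d q) v), v + LinearMap.adjoint (X.d (q + 1)) u) := by
  refine ext_inner_right ℂ fun w => ?_
  obtain ⟨⟨a, b⟩, rfl⟩ := (coneE hZ q).surjective w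
  rw [LinearMap.adjoint_inner_left, d_succ, inner_coneE, inner_coneE]
  simp only [inner_add_left, inner_add_right, inner_neg_left, inner_neg_right,
    LinearMap.adjoint_inner_left]
  ring

lemma lap_coneE (hZ : ConeIso X X (fun _ => LinearMap.id) Z) (q : ℕ) (v : X.C q) (u : X.C (q + 1)) :
    Z.lap (q + 1) (coneE hZ q (v, u)) =
      coneE hZ q ((1 + X.lap q) v, (1 + X.lap (q + 1)) u) := by
  cases q with
  | zero =>
    simp only [lap, LinearMap.add_apply, LinearMap.comp_apply, Module.End.one_apply]
    rw [d_succ, adj_succ, adj_zero, d_zero, ← map_add]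
    congr 1
    ext
    · simp only [Prod.mk_add_mk, map_add, map_neg]; abel
    · simp only [Prod.mk_add_mk, map_add, map_neg]; abel
  | succ q =>
    simp only [lap, LinearMap.add_apply, LinearMap.comp_apply, Module.End.one_apply]
    rw [d_succ, adj_succ, adj_succ, d_succ, ← map_add]
    congr 1
    ext
    · simp only [Prod.mk_add_mk, map_add, map_neg]; abel
    · simp only [Prod.mk_add_mk, map_add, map_neg]; abel


lemma log_det_lap (hZ : ConeIso X X (fun _ => LinearMap.id) Z) (q : ℕ) :
    Real.log (LinearMap.det (Z.lap (q + 1))).re =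
      X.gam q + 2 * X.gam (q + 1) + X.gam (q + 2) := by
  have h : Z.lap (q + 1) = (coneE hZ q : _ →ₗ[ℂ] _) ∘ₗ
      (LinearMap.prodMap (1 + X.lap q) (1 + X.lap (q + 1))) ∘ₗ
        ((coneE hZ q).symm : _ →ₗ[ℂ] _) := by
    ext z
    obtain ⟨⟨a, b⟩, rfl⟩ := (coneE hZ q).surjective z
    rw [lap_coneE]
    simp
  rw [h, LinearMap.det_conj, LinearMap.det_prodMap, det_one_add_lap, det_one_add_lap,
    ← Complex.ofReal_mul, Complex.ofReal_re, ← Real.exp_add, Real.log_exp]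
  ring


lemma cone_acyclic (hZ : ConeIso X X (fun _ => LinearMap.id) Z) : Z.Acyclic := by
  constructor
  · rw [LinearMap.ker_eq_bot']
    intro z hz
    obtain ⟨u, rfl⟩ := hZ.e0.surjective z
    rw [d_zero, LinearEquiv.map_eq_zero_iff, Prod.mk_eq_zero] at hz
    rw [hz.1, map_zero]
  · intro q
    apply le_antisymm
    · intro z hz
      obtain ⟨⟨v, u⟩, rfl⟩ := (coneE hZ q).surjective z
      rw [LinearMap.mem_ker, d_succ, LinearEquiv.map_eq_zero_iff, Prod.mk_eq_zero] at hz
      have hu : u = X.d q v := (neg_add_eq_zero.mp hz.1).symm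
      subst hu
      cases q with
      | zero => exact ⟨hZ.e0 v, d_zero hZ v⟩
      | succ q => exact ⟨coneE hZ q (0, v), by rw [d_succ]; simp⟩
    · rw [LinearMap.range_le_ker_iff]
      exact Z.dd q

end Cone

lemma alt_sum (g : ℕ → ℝ) (h0 : g 0 = 0) (L : ℕ → ℝ)
    (hL : ∀ q, L (q + 1) = g q + 2 * g (q + 1) + g (q + 2)) (n : ℕ) :
    ∑ q ∈ Finset.range (n + 1), (-1 : ℝ) ^ (q + 1) * (q : ℝ) * L q =
      (-1) ^ (n + 1) * (n * g (n + 1) + (n + 1) * g n) := by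
  induction n with
  | zero => simp [h0]
  | succ n ih =>
    rw [Finset.sum_range_succ, ih, hL]
    push_cast
    ring

end FinComplex

open FinComplex in
/-- **Lemma 1.13 (i) of [BFK, "Relative torsion"]** (finite-dimensional case `𝒜 = ℂ`).
The mapping cone of the identity morphism of a cochain complex of finite-dimensional
complex inner product spaces is an acyclic cochain complex, and `T(C(id)) = 1`,
i.e. `log T(C(id)) = 0`. -/
theorem torsion_cone_of_id (N : ℕ) (X : FinComplex N) (Z : FinComplex (N + 1))
    (hZ : ConeIso X X (fun _ => LinearMap.id) Z) :
    Z.Acyclic ∧ Z.logT = 0 := by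
  refine ⟨cone_acyclic hZ, ?_⟩
  rw [logT, alt_sum X.gam rfl (fun q => Real.log ((LinearMap.det (Z.lap q)).re))
    (log_det_lap hZ) (N + 1), gam_beyond X N le_rfl, gam_beyond X (N + 1) (by omega)]
  simp
end
end

section
/- Let (C, d₁) and (C, d₂) be two cochain complexes on the same finite-dimensional complex inner product spaces C_j, and let f : (C, d₁) → (C, d₂) be an isomorphism of complexes, i.e. each f_j : C_j → C_j is bijective and f_{j+1} d_{1,j} = d_{2,j} f_j for all j. Then the mapping cone C(f) is an acyclic cochain complex and log T(C(f)) = Σ_j (−1)^j log vol(f_j). -/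
noncomputable section

open LinearMap

namespace ConeAux

set_option linter.unusedSectionVars false
set_option linter.unusedSimpArgs false

variable {E H K : Type} [NormedAddCommGroup E] [InnerProductSpace ℂ E] [FiniteDimensional ℂ E]
  [NormedAddCommGroup H] [InnerProductSpace ℂ H] [FiniteDimensional ℂ H]
  [NormedAddCommGroup K] [InnerProductSpace ℂ K] [FiniteDimensional ℂ K]

/-- first inclusion -/
def il (E H : Type) [NormedAddCommGroup E] [InnerProductSpace ℂ E]
    [NormedAddCommGroup H] [InnerProductSpace ℂ H] : E →ₗ[ℂ] WithLp 2 (E × H) :=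
  (WithLp.linearEquiv 2 ℂ (E × H)).symm.toLinearMap ∘ₗ LinearMap.inl ℂ E H

/-- second inclusion -/
def ir (E H : Type) [NormedAddCommGroup E] [InnerProductSpace ℂ E]
    [NormedAddCommGroup H] [InnerProductSpace ℂ H] : H →ₗ[ℂ] WithLp 2 (E × H) :=
  (WithLp.linearEquiv 2 ℂ (E × H)).symm.toLinearMap ∘ₗ LinearMap.inr ℂ E H

/-- first projection -/
def pl (E H : Type) [NormedAddCommGroup E] [InnerProductSpace ℂ E]
    [NormedAddCommGroup H] [InnerProductSpace ℂ H] : WithLp 2 (E × H) →ₗ[ℂ] E :=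
  LinearMap.fst ℂ E H ∘ₗ (WithLp.linearEquiv 2 ℂ (E × H)).toLinearMap

/-- second projection -/
def pr (E H : Type) [NormedAddCommGroup E] [InnerProductSpace ℂ E]
    [NormedAddCommGroup H] [InnerProductSpace ℂ H] : WithLp 2 (E × H) →ₗ[ℂ] H :=
  LinearMap.snd ℂ E H ∘ₗ (WithLp.linearEquiv 2 ℂ (E × H)).toLinearMap

lemma adj_il : adjoint (il E H) = pl E H := by
  symm
  rw [LinearMap.eq_adjoint_iff]
  intro x y
  simp [il, pl, WithLp.prod_inner_apply]

lemma adj_ir : adjoint (ir E H) = pr E H := by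
  symm
  rw [LinearMap.eq_adjoint_iff]
  intro x y
  simp [ir, pr, WithLp.prod_inner_apply]

lemma adj_pl : adjoint (pl E H) = il E H := by
  rw [← adj_il, LinearMap.adjoint_adjoint]

lemma adj_pr : adjoint (pr E H) = ir E H := by
  rw [← adj_ir, LinearMap.adjoint_adjoint]

lemma pl_il (x : E) : pl E H (il E H x) = x := by simp [pl, il]
lemma pr_ir (x : H) : pr E H (ir E H x) = x := by simp [pr, ir]
lemma pl_ir (x : H) : pl E H (ir E H x) = 0 := by simp [pl, ir]
lemma pr_il (x : E) : pr E H (il E H x) = 0 := by simp [pr, il]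
lemma il_pl (x : WithLp 2 (E × H)) : il E H (pl E H x) + ir E H (pr E H x) = x := by
  apply (WithLp.linearEquiv 2 ℂ (E × H)).injective
  simp [pr, il, pl, ir]
  rfl

lemma prod_ext {x y : WithLp 2 (E × H)} (h1 : pl E H x = pl E H y) (h2 : pr E H x = pr E H y) :
    x = y := by
  rw [← il_pl x, ← il_pl y, h1, h2]

/-- block diagonal operators -/
def dg (A : E →ₗ[ℂ] E) (B : H →ₗ[ℂ] H) : WithLp 2 (E × H) →ₗ[ℂ] WithLp 2 (E × H) :=
  il E H ∘ₗ A ∘ₗ pl E H + ir E H ∘ₗ B ∘ₗ pr E H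

lemma det_dg (A : E →ₗ[ℂ] E) (B : H →ₗ[ℂ] H) :
    LinearMap.det (dg A B) = LinearMap.det A * LinearMap.det B := by
  rw [← LinearMap.det_prodMap, ← LinearMap.det_conj _ (WithLp.linearEquiv 2 ℂ (E × H)).symm]
  congr 1
  ext1 x
  apply prod_ext <;> simp [dg, il, ir, pl, pr]

/-- The rotation-like operator `(v,u) ↦ (v + s^* u, u - s v)`. -/
def W (s : E →ₗ[ℂ] H) : WithLp 2 (E × H) →ₗ[ℂ] WithLp 2 (E × H) :=
  LinearMap.id + (il E H ∘ₗ adjoint s ∘ₗ pr E H - ir E H ∘ₗ s ∘ₗ pl E H)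

lemma adj_W (s : E →ₗ[ℂ] H) : adjoint (W s) =
    LinearMap.id - (il E H ∘ₗ adjoint s ∘ₗ pr E H - ir E H ∘ₗ s ∘ₗ pl E H) := by
  have : adjoint (LinearMap.id : WithLp 2 (E × H) →ₗ[ℂ] _) = LinearMap.id := by
    symm
    rw [LinearMap.eq_adjoint_iff]
    simp
  simp only [W, map_add, map_sub, LinearMap.adjoint_comp, adj_il, adj_ir, adj_pl, adj_pr,
    LinearMap.adjoint_adjoint, this, LinearMap.comp_assoc]
  abel

lemma W_adj_W (s : E →ₗ[ℂ] H) : W s ∘ₗ adjoint (W s) =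
    dg (LinearMap.id + adjoint s ∘ₗ s) (LinearMap.id + s ∘ₗ adjoint s) := by
  rw [adj_W]
  ext1 x
  apply prod_ext <;> simp [W, dg, pl_il, pl_ir, pr_il, pr_ir] <;> abel

lemma det_sylv (s : E →ₗ[ℂ] H) : LinearMap.det (LinearMap.id + s ∘ₗ adjoint s) =
    LinearMap.det (LinearMap.id + adjoint s ∘ₗ s) := by
  classical
  let b := Module.finBasis ℂ E
  let c := Module.finBasis ℂ H
  rw [← LinearMap.det_toMatrix b, ← LinearMap.det_toMatrix c, map_add, map_add,
    LinearMap.toMatrix_id, LinearMap.toMatrix_id, LinearMap.toMatrix_comp c b c,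
    LinearMap.toMatrix_comp b c b, Matrix.det_one_add_mul_comm]

/-- the determinant `det (1 + s^* s)` -/
def S (s : E →ₗ[ℂ] H) : ℂ := LinearMap.det (LinearMap.id + adjoint s ∘ₗ s)

lemma det_W (s : E →ₗ[ℂ] H) :
    LinearMap.det (adjoint (W s)) * LinearMap.det (W s) = S s * S s := by
  rw [mul_comm, ← LinearMap.det_comp, W_adj_W, det_dg, det_sylv, S]

/-- graph embedding -/
def gr (s : E →ₗ[ℂ] H) : E →ₗ[ℂ] WithLp 2 (E × H) := il E H + ir E H ∘ₗ s

lemma gr_eq (s : E →ₗ[ℂ] H) : gr s = adjoint (W s) ∘ₗ il E H := by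
  rw [adj_W]
  ext1 x
  apply prod_ext <;> simp [gr, pl_il, pl_ir, pr_il, pr_ir]

lemma gr_adj_gr (s : E →ₗ[ℂ] H) : adjoint (gr s) ∘ₗ gr s = LinearMap.id + adjoint s ∘ₗ s := by
  ext1 x
  simp [gr, LinearMap.adjoint_comp, adj_il, adj_ir, pl_il, pl_ir, pr_il, pr_ir]

lemma adj_equiv (e : E ≃ₗᵢ[ℂ] H) : adjoint (e.toLinearEquiv : E →ₗ[ℂ] H) =
    (e.toLinearEquiv.symm : H →ₗ[ℂ] E) := by
  symm
  rw [LinearMap.eq_adjoint_iff]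
  intro x y
  have := e.inner_map_map (e.symm x) y
  simpa using this.symm

lemma adj_equiv_symm (e : E ≃ₗᵢ[ℂ] H) : adjoint (e.toLinearEquiv.symm : H →ₗ[ℂ] E) =
    (e.toLinearEquiv : E →ₗ[ℂ] H) := by
  rw [← adj_equiv, LinearMap.adjoint_adjoint]

lemma det_conj_adj (f : E ≃ₗ[ℂ] H) (B : E →ₗ[ℂ] E) :
    LinearMap.det ((f : E →ₗ[ℂ] H) ∘ₗ B ∘ₗ adjoint (f : E →ₗ[ℂ] H)) =
     LinearMap.det (adjoint (f : E →ₗ[ℂ] H) ∘ₗ (f : E →ₗ[ℂ] H)) * LinearMap.det B := by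
  rw [mul_comm, ← LinearMap.det_comp, ← LinearMap.det_conj _ f]
  congr 1
  ext x
  simp

lemma det_pos (A : E →ₗ[ℂ] E) (hA : A.IsPositive) (hi : Function.Injective A) :
    ∃ r : ℝ, 0 < r ∧ LinearMap.det A = (r : ℂ) := by
  have h1 : LinearMap.det A ≠ 0 := by
    intro h
    have := LinearMap.bot_lt_ker_of_det_eq_zero h
    rw [LinearMap.ker_eq_bot.mpr hi] at this
    exact lt_irrefl _ this
  have h2 := hA.isSymmetric.det_eq_prod_eigenvalues rfl
  have h3 : 0 ≤ ∏ i, hA.isSymmetric.eigenvalues rfl i :=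
    Finset.prod_nonneg fun i _ => hA.nonneg_eigenvalues rfl i
  replace h2 : LinearMap.det A = ((∏ i, hA.isSymmetric.eigenvalues rfl i : ℝ) : ℂ) :=
    h2.trans (Complex.ofReal_prod _ _).symm
  refine ⟨_, lt_of_le_of_ne h3 ?_, h2⟩
  intro h
  rw [← h] at h2
  exact h1 (by simpa using h2)

lemma isPos (f : E →ₗ[ℂ] H) : (adjoint f ∘ₗ f).IsPositive := by
  constructor
  · intro x y
    simp [LinearMap.adjoint_inner_left, LinearMap.adjoint_inner_right]
  · intro x
    simp only [LinearMap.comp_apply, LinearMap.adjoint_inner_left]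
    exact inner_self_nonneg (𝕜 := ℂ) (x := f x)

lemma F_pos (f : E →ₗ[ℂ] H) (hf : Function.Injective f) :
    ∃ r : ℝ, 0 < r ∧ LinearMap.det (adjoint f ∘ₗ f) = (r : ℂ) := by
  apply det_pos _ (isPos f)
  rw [injective_iff_map_eq_zero]
  intro x hx
  have : inner ℂ (f x) (f x) = 0 := by
    rw [← LinearMap.adjoint_inner_left]
    simp only [LinearMap.comp_apply] at hx
    simp [hx]
  exact hf (by simpa using this)

lemma S_pos (s : E →ₗ[ℂ] H) : ∃ r : ℝ, 0 < r ∧ S s = (r : ℂ) := by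
  rw [S, ← gr_adj_gr]
  apply F_pos
  intro x y h
  have := congrArg (pl E H) h
  simpa [gr, pl_il, pl_ir] using this

/-- The key computation for a single Laplacian. -/
lemma det_lap {Z0 Z1 Z2 Y1 K' : Type}
    [NormedAddCommGroup Z0] [InnerProductSpace ℂ Z0] [FiniteDimensional ℂ Z0]
    [NormedAddCommGroup Z1] [InnerProductSpace ℂ Z1] [FiniteDimensional ℂ Z1]
    [NormedAddCommGroup Z2] [InnerProductSpace ℂ Z2] [FiniteDimensional ℂ Z2]
    [NormedAddCommGroup Y1] [InnerProductSpace ℂ Y1] [FiniteDimensional ℂ Y1]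
    [NormedAddCommGroup K'] [InnerProductSpace ℂ K'] [FiniteDimensional ℂ K']
    (s : E →ₗ[ℂ] H) (t : Y1 →ₗ[ℂ] K') (f : H ≃ₗ[ℂ] Y1)
    (e1 : WithLp 2 (E × H) ≃ₗᵢ[ℂ] Z1) (e2 : WithLp 2 (Y1 × K') ≃ₗᵢ[ℂ] Z2)
    (ρ : Z0 →ₗ[ℂ] E) (d0 : Z0 →ₗ[ℂ] Z1) (d1 : Z1 →ₗ[ℂ] Z2)
    (h0 : d0 = (e1.toLinearEquiv : _ →ₗ[ℂ] _) ∘ₗ gr s ∘ₗ ρ)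
    (h1 : d1 = (e2.toLinearEquiv : _ →ₗ[ℂ] _) ∘ₗ gr t ∘ₗ
      ((f : H →ₗ[ℂ] Y1) ∘ₗ pr E H ∘ₗ W s ∘ₗ (e1.toLinearEquiv.symm : _ →ₗ[ℂ] _))) :
    LinearMap.det (adjoint d1 ∘ₗ d1 + d0 ∘ₗ adjoint d0) =
      S s * S s * (LinearMap.det (ρ ∘ₗ adjoint ρ) *
        (LinearMap.det (adjoint (f : H →ₗ[ℂ] Y1) ∘ₗ (f : H →ₗ[ℂ] Y1)) * S t)) := by
  have key : adjoint d1 ∘ₗ d1 + d0 ∘ₗ adjoint d0 =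
      (e1.toLinearEquiv : _ →ₗ[ℂ] _) ∘ₗ (adjoint (W s) ∘ₗ
        dg (ρ ∘ₗ adjoint ρ) (adjoint (f : H →ₗ[ℂ] Y1) ∘ₗ (adjoint (gr t) ∘ₗ gr t) ∘ₗ
          (f : H →ₗ[ℂ] Y1)) ∘ₗ W s) ∘ₗ (e1.toLinearEquiv.symm : _ →ₗ[ℂ] _) := by
    rw [h0, h1, gr_eq s]
    simp only [LinearMap.adjoint_comp, LinearMap.adjoint_adjoint, adj_equiv, adj_equiv_symm,
      adj_pr, adj_il, dg]
    ext1 x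
    simp only [LinearMap.comp_apply, LinearMap.add_apply, map_add, LinearEquiv.coe_coe,
      LinearEquiv.symm_apply_apply]
    exact add_comm _ _
  have hdet : LinearMap.det (adjoint (f : H →ₗ[ℂ] Y1) ∘ₗ (adjoint (gr t) ∘ₗ gr t) ∘ₗ
          (f : H →ₗ[ℂ] Y1)) =
      LinearMap.det (adjoint (f : H →ₗ[ℂ] Y1) ∘ₗ (f : H →ₗ[ℂ] Y1)) * S t := by
    rw [gr_adj_gr, S, ← LinearMap.det_conj (LinearMap.id + adjoint t ∘ₗ t) f.symm,
      ← LinearMap.det_comp]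
    congr 1
    ext1 x
    simp
  rw [key]
  rw [LinearMap.det_conj, LinearMap.det_comp, LinearMap.det_comp, det_dg, hdet, ← det_W]
  ring

lemma det_rho (s : E →ₗ[ℂ] H) {Z1 : Type}
    [NormedAddCommGroup Z1] [InnerProductSpace ℂ Z1] [FiniteDimensional ℂ Z1]
    (f : H ≃ₗ[ℂ] K) (e1 : WithLp 2 (E × H) ≃ₗᵢ[ℂ] Z1) (ρ : Z1 →ₗ[ℂ] K)
    (h : ρ = (f : H →ₗ[ℂ] K) ∘ₗ pr E H ∘ₗ W s ∘ₗ (e1.toLinearEquiv.symm : _ →ₗ[ℂ] _)) :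
    LinearMap.det (ρ ∘ₗ adjoint ρ) =
      LinearMap.det (adjoint (f : H →ₗ[ℂ] K) ∘ₗ (f : H →ₗ[ℂ] K)) * S s := by
  rw [S, ← det_sylv, ← det_conj_adj]
  congr 1
  have hW := W_adj_W s
  rw [h]
  simp only [LinearMap.adjoint_comp, LinearMap.adjoint_adjoint, adj_equiv, adj_equiv_symm,
      adj_pr, adj_il]
  ext1 x
  have := LinearMap.congr_fun hW (ir E H (adjoint (f : H →ₗ[ℂ] K) x))
  simp only [LinearMap.comp_apply] at this
  simp [this, dg, pl_il, pl_ir, pr_il, pr_ir]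

lemma det_rho0 {Z1 : Type}
    [NormedAddCommGroup Z1] [InnerProductSpace ℂ Z1] [FiniteDimensional ℂ Z1]
    (f : H ≃ₗ[ℂ] K) (e1 : H ≃ₗᵢ[ℂ] Z1) (ρ : Z1 →ₗ[ℂ] K)
    (h : ρ = (f : H →ₗ[ℂ] K) ∘ₗ (e1.toLinearEquiv.symm : _ →ₗ[ℂ] _)) :
    LinearMap.det (ρ ∘ₗ adjoint ρ) =
      LinearMap.det (adjoint (f : H →ₗ[ℂ] K) ∘ₗ (f : H →ₗ[ℂ] K)) := by
  have := det_conj_adj f LinearMap.id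
  rw [LinearMap.det_id, mul_one] at this
  rw [← this]
  congr 1
  rw [h]
  simp only [LinearMap.adjoint_comp, adj_equiv_symm]
  ext1 x
  simp

lemma alt_sum (F g : ℕ → ℝ) (n : ℕ) :
    ∑ k ∈ Finset.range n, (-1 : ℝ) ^ k * ((k : ℝ) + 1) *
      (2 * g (k + 1) + (F k + g k) + (F (k + 1) + g (k + 2))) =
    ∑ k ∈ Finset.range n, (-1 : ℝ) ^ k * F k + g 0 - (-1) ^ n * g n
      - (-1) ^ n * n * (g n + g (n + 1) + F n) := by
  induction n with
  | zero => simp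
  | succ n ih =>
    rw [Finset.sum_range_succ, ih, Finset.sum_range_succ]
    push_cast
    ring

end ConeAux

open FinComplex in
/-- **Proposition 1.12 of [BFK, "Relative torsion"]** (finite-dimensional case `𝒜 = ℂ`).
If `f : (C, d₁) → (C, d₂)` is an isomorphism of cochain complexes of finite-dimensional
complex inner product spaces, then the mapping cone `C(f)` is acyclic and
`log T(C(f)) = Σ_j (-1)^j log vol(f_j)`, where `vol g = det(g^* g)^{1/2}`. -/
theorem torsion_cone_of_iso (N : ℕ) (X Y : FinComplex N)
    (f : ∀ q, X.C q →ₗ[ℂ] Y.C q) (hmor : IsMorphism X Y f)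
    (hbij : ∀ q, Function.Bijective (f q))
    (Z : FinComplex (N + 1)) (hZ : ConeIso X Y f Z) :
    Z.Acyclic ∧
      Z.logT = ∑ q ∈ Finset.range (N + 1), (-1 : ℝ) ^ q * logvol (f q) := by
  constructor
  · constructor
    · rw [LinearMap.ker_eq_bot, injective_iff_map_eq_zero]
      intro z hz
      obtain ⟨u, rfl⟩ := hZ.e0.surjective z
      rw [hZ.compat0] at hz
      have h1 := (map_eq_zero_iff _ (hZ.e 0).injective).mp hz
      have h2 : f 0 u = 0 := congrArg (fun p => (WithLp.equiv 2 _ p).1) h1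
      have h3 : u = 0 := (hbij 0).1 (by simpa using h2)
      simp [h3]
    · intro q
      apply le_antisymm
      · intro z hz
        obtain ⟨p, rfl⟩ := (hZ.e q).surjective z
        obtain ⟨⟨v, u⟩, rfl⟩ := (WithLp.equiv 2 _).symm.surjective p
        rw [LinearMap.mem_ker, hZ.compat] at hz
        have h1 := (map_eq_zero_iff _ (hZ.e (q + 1)).injective).mp hz
        have h2 : -(Y.d q v) + f (q + 1) u = 0 := congrArg (fun p => (WithLp.equiv 2 _ p).1) h1
        obtain ⟨w, rfl⟩ := (hbij q).2 v
        have h3 : X.d q w = u := by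
          apply (hbij (q + 1)).1
          rw [hmor]
          exact (neg_add_eq_zero.mp h2)
        subst h3
        cases q with
        | zero => exact ⟨hZ.e0 w, hZ.compat0 w⟩
        | succ q =>
          refine ⟨hZ.e q ((WithLp.equiv 2 _).symm (0, w)), ?_⟩
          rw [hZ.compat]
          simp
      · rintro _ ⟨z, rfl⟩
        exact LinearMap.congr_fun (Z.dd q) z
  · let fe : ∀ q, X.C q ≃ₗ[ℂ] Y.C q := fun q => LinearEquiv.ofBijective (f q) (hbij q)
    have hfe : ∀ q, ((fe q : X.C q ≃ₗ[ℂ] Y.C q) : X.C q →ₗ[ℂ] Y.C q) = f q := fun q => rfl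
    have hfe' : ∀ q x, fe q x = f q x := fun q x => rfl
    let s : ∀ q, Y.C q →ₗ[ℂ] X.C (q + 1) := fun q => X.d q ∘ₗ ((fe q).symm : Y.C q →ₗ[ℂ] X.C q)
    have hs : ∀ q x, s q (f q x) = X.d q x := fun q x => by
      simp [s, ← hfe']
    have hfs : ∀ q v, f (q + 1) (s q v) = Y.d q v := fun q v => by
      obtain ⟨w, rfl⟩ := (hbij q).2 v
      rw [hs, hmor]
    have hss : ∀ q v, s (q + 1) (Y.d q v) = 0 := fun q v => by
      rw [← hfs, hs]
      exact LinearMap.congr_fun (X.dd q) _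
    have hd0 : Z.d 0 = ((hZ.e 0).toLinearEquiv : _ →ₗ[ℂ] _) ∘ₗ ConeAux.gr (s 0) ∘ₗ
        ((fe 0 : X.C 0 →ₗ[ℂ] Y.C 0) ∘ₗ (hZ.e0.toLinearEquiv.symm : _ →ₗ[ℂ] _)) := by
      ext1 z
      obtain ⟨u, rfl⟩ := hZ.e0.surjective z
      rw [hZ.compat0]
      simp only [LinearMap.comp_apply, LinearEquiv.coe_coe, LinearIsometryEquiv.coe_toLinearEquiv]
      congr 1
      apply ConeAux.prod_ext <;>
        simp [ConeAux.gr, ConeAux.il, ConeAux.ir, ConeAux.pl, ConeAux.pr, hfe', hs]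
    have hd1 : ∀ q, Z.d (q + 1) = ((hZ.e (q + 1)).toLinearEquiv : _ →ₗ[ℂ] _) ∘ₗ
        ConeAux.gr (s (q + 1)) ∘ₗ
        ((fe (q + 1) : X.C (q + 1) →ₗ[ℂ] Y.C (q + 1)) ∘ₗ ConeAux.pr _ _ ∘ₗ ConeAux.W (s q) ∘ₗ
          ((hZ.e q).toLinearEquiv.symm : _ →ₗ[ℂ] _)) := by
      intro q
      ext1 z
      obtain ⟨p, rfl⟩ := (hZ.e q).surjective z
      obtain ⟨⟨v, u⟩, rfl⟩ := (WithLp.equiv 2 _).symm.surjective p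
      rw [hZ.compat]
      simp only [LinearMap.comp_apply, LinearEquiv.coe_coe, LinearIsometryEquiv.coe_toLinearEquiv]
      congr 1
      apply ConeAux.prod_ext <;>
        simp [ConeAux.gr, ConeAux.W, ConeAux.il, ConeAux.ir, ConeAux.pl, ConeAux.pr, hfe', hs,
          hfs, hss, add_comm, sub_eq_add_neg]
    choose F hFpos hF using fun q => ConeAux.F_pos (f q) (hbij q).1
    choose G hGpos hG using fun q => ConeAux.S_pos (s q)
    -- the determinants
    let G' : ℕ → ℝ := fun q => Nat.casesOn q 1 G
    have hG'pos : ∀ q, 0 < G' q := by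
      intro q
      cases q with
      | zero => exact one_pos
      | succ q => exact hGpos q
    have hdet : ∀ q, LinearMap.det (Z.lap (q + 1)) =
        ((G q * G q * ((F q * G' q) * (F (q + 1) * G (q + 1))) : ℝ) : ℂ) := by
      intro q
      cases q with
      | zero =>
        have h := ConeAux.det_lap (s 0) (s 1) (fe 1) (hZ.e 0) (hZ.e 1) _ _ _ hd0 (hd1 0)
        rw [ConeAux.det_rho0 (fe 0) hZ.e0 _ rfl, hfe, hfe, hF, hF, hG, hG] at h
        refine h.trans ?_
        simp [G']
      | succ q =>
        have h := ConeAux.det_lap (s (q + 1)) (s (q + 2)) (fe (q + 2)) (hZ.e (q + 1))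
          (hZ.e (q + 2)) _ _ _ (hd1 q) (hd1 (q + 1))
        rw [ConeAux.det_rho (s q) (fe (q + 1)) (hZ.e q) _ rfl, hfe, hfe, hF, hF, hG, hG, hG] at h
        refine h.trans ?_
        simp [G']
    have hlog : ∀ q, Real.log ((LinearMap.det (Z.lap (q + 1))).re) =
        2 * Real.log (G' (q + 1)) + (Real.log (F q) + Real.log (G' q)) +
          (Real.log (F (q + 1)) + Real.log (G' (q + 2))) := by
      intro q
      have a1 := (hGpos q).ne'
      have a2 := (hGpos (q + 1)).ne'
      have a3 := (hFpos q).ne'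
      have a4 := (hFpos (q + 1)).ne'
      have a5 := (hG'pos q).ne'
      rw [hdet, Complex.ofReal_re, Real.log_mul (by positivity) (by positivity),
        Real.log_mul a1 a1, Real.log_mul (by positivity) (by positivity),
        Real.log_mul a3 a5, Real.log_mul a4 a2]
      change _ = 2 * Real.log (G q) + _ + (_ + Real.log (G (q + 1)))
      ring
    have hs0 : ∀ q, N ≤ q → G q = 1 := by
      intro q hq
      have h0 : s q = 0 := by
        ext1 v
        exact X.trivial_beyond (q + 1) (by omega) _
      have := hG q
      rw [ConeAux.S, h0, LinearMap.comp_zero, add_zero, LinearMap.det_id] at this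
      exact_mod_cast this.symm
    have hF0 : F (N + 1) = 1 := by
      have h0 : adjoint (f (N + 1)) ∘ₗ f (N + 1) = LinearMap.id := by
        ext1 v
        rw [X.trivial_beyond (N + 1) (by omega) v, map_zero, map_zero]
      have := hF (N + 1)
      rw [h0, LinearMap.det_id] at this
      exact_mod_cast this.symm
    have hvol : ∀ q, logvol (f q) = 1 / 2 * Real.log (F q) := by
      intro q
      rw [logvol, hF, Complex.ofReal_re]
    have hsum := ConeAux.alt_sum (fun q => Real.log (F q)) (fun q => Real.log (G' q)) (N + 1)
    have e1 : G' (N + 1) = 1 := hs0 N le_rfl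
    have e2 : G' (N + 1 + 1) = 1 := hs0 (N + 1) (by omega)
    have e3 : G' 0 = 1 := rfl
    simp only [e1, e2, e3, hF0, Real.log_one] at hsum
    rw [logT, Finset.sum_range_succ']
    simp only [hlog, hvol]
    have : ∑ k ∈ Finset.range (N + 1), (-1 : ℝ) ^ k * (1 / 2 * Real.log (F k)) =
        1 / 2 * ∑ k ∈ Finset.range (N + 1), (-1 : ℝ) ^ k * Real.log (F k) := by
      rw [Finset.mul_sum]
      exact Finset.sum_congr rfl fun k _ => by ring
    rw [this]
    congr 1
    simp only [mul_zero, add_zero, sub_zero, Nat.cast_zero, zero_mul] at hsum ⊢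
    rw [← hsum]
    refine Finset.sum_congr rfl fun k _ => ?_
    push_cast
    ring
end
end

section
/- Let (C¹, d₁) and (C², d₂) be acyclic cochain complexes of finite-dimensional complex inner product spaces, and let f_i : C²_i → C¹_{i+1} be linear maps satisfying f_{i+1} d_{2,i} + d_{1,i+1} f_i = 0 for all i. Define the cochain complex (C, d) by C_i := C¹_i ⊕ C²_i and d_i(u, v) := (d_{1,i} u + f_i v, d_{2,i} v). Then (C, d) is an acyclic cochain complex of finite-dimensional complex inner product spaces and log T(C) = log T(C¹) + log T(C²). -/
noncomputable section

open LinearMap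

namespace TorsionAux

set_option linter.unusedSectionVars false

section Abstract

variable {E K L E' K' L' : Type*}
  [NormedAddCommGroup E] [InnerProductSpace ℂ E] [FiniteDimensional ℂ E]
  [NormedAddCommGroup K] [InnerProductSpace ℂ K] [FiniteDimensional ℂ K]
  [NormedAddCommGroup L] [InnerProductSpace ℂ L] [FiniteDimensional ℂ L]
  [NormedAddCommGroup E'] [InnerProductSpace ℂ E'] [FiniteDimensional ℂ E']
  [NormedAddCommGroup K'] [InnerProductSpace ℂ K'] [FiniteDimensional ℂ K']
  [NormedAddCommGroup L'] [InnerProductSpace ℂ L'] [FiniteDimensional ℂ L']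

/-- Weinstein–Aronszajn for linear maps. -/
theorem det_one_add_comm (A : K →ₗ[ℂ] E) (B : E →ₗ[ℂ] K) :
    LinearMap.det (1 + A ∘ₗ B) = LinearMap.det (1 + B ∘ₗ A) := by
  let b := Module.finBasis ℂ E
  let c := Module.finBasis ℂ K
  rw [← LinearMap.det_toMatrix b, ← LinearMap.det_toMatrix c, map_add, map_add,
    LinearMap.toMatrix_comp b c b, LinearMap.toMatrix_comp c b c,
    LinearMap.toMatrix_one, LinearMap.toMatrix_one, Matrix.det_one_add_mul_comm]

theorem det_adj (A : E →ₗ[ℂ] E) :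
    LinearMap.det (LinearMap.adjoint A) = star (LinearMap.det A) := by
  let b := stdOrthonormalBasis ℂ E
  rw [← LinearMap.det_toMatrix b.toBasis, ← LinearMap.det_toMatrix b.toBasis,
    LinearMap.toMatrix_adjoint b b, Matrix.det_conjTranspose]

/-- The situation `0 → K → E → L → 0` exact, with `K → E` isometric. -/
structure SES (i : K →ₗ[ℂ] E) (p : E →ₗ[ℂ] L) : Prop where
  iso : LinearMap.adjoint i ∘ₗ i = 1
  ex : LinearMap.ker p = LinearMap.range i
  surj : LinearMap.range p = ⊤

variable {i : K →ₗ[ℂ] E} {p : E →ₗ[ℂ] L}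

theorem SES.pi (h : SES i p) : p ∘ₗ i = 0 := by
  ext x
  have : i x ∈ LinearMap.ker p := by rw [h.ex]; exact ⟨x, rfl⟩
  simpa using this

theorem SES.ip (h : SES i p) : LinearMap.adjoint i ∘ₗ LinearMap.adjoint p = 0 := by
  rw [← LinearMap.adjoint_comp, h.pi, map_zero]

theorem SES.det_ne (h : SES i p) : LinearMap.det (p ∘ₗ LinearMap.adjoint p) ≠ 0 := by
  intro h0
  rw [LinearMap.det_eq_zero_iff_ker_ne_bot] at h0
  apply h0
  rw [LinearMap.ker_self_comp_adjoint, ← LinearMap.orthogonal_range, h.surj,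
    Submodule.top_orthogonal_eq_bot]

theorem exists_inv (T : L →ₗ[ℂ] L) (hT : LinearMap.det T ≠ 0) :
    ∃ R : L →ₗ[ℂ] L, T ∘ₗ R = 1 ∧ R ∘ₗ T = 1 := by
  have hu : IsUnit T := (LinearMap.isUnit_iff_isUnit_det T).2 (isUnit_iff_ne_zero.2 hT)
  obtain ⟨R, hR⟩ := hu.exists_right_inv
  obtain ⟨S, hS⟩ := hu.exists_left_inv
  have : S = R := left_inv_eq_right_inv hS hR
  exact ⟨R, hR, this ▸ hS⟩

theorem SES.exists_R (h : SES i p) : ∃ R : L →ₗ[ℂ] L,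
    (p ∘ₗ LinearMap.adjoint p) ∘ₗ R = 1 ∧ R ∘ₗ (p ∘ₗ LinearMap.adjoint p) = 1 ∧
    i ∘ₗ LinearMap.adjoint i + LinearMap.adjoint p ∘ₗ R ∘ₗ p = 1 := by
  obtain ⟨R, h1, h2⟩ := exists_inv _ h.det_ne
  refine ⟨R, h1, h2, ?_⟩
  ext x
  have hy : x - LinearMap.adjoint p (R (p x)) ∈ LinearMap.ker p := by
    have := LinearMap.congr_fun h1 (p x)
    simp only [LinearMap.comp_apply, Module.End.one_apply] at this
    rw [LinearMap.mem_ker, map_sub, this, sub_self]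
  rw [h.ex] at hy
  obtain ⟨k, hk⟩ := hy
  have e1 : LinearMap.adjoint i (i k) = k := LinearMap.congr_fun h.iso k
  have e2 : LinearMap.adjoint i (LinearMap.adjoint p (R (p x))) = 0 :=
    LinearMap.congr_fun h.ip _
  have e3 : LinearMap.adjoint i x = k := by
    rw [hk, map_sub, e2, sub_zero] at e1; exact e1
  simp only [LinearMap.add_apply, LinearMap.comp_apply, Module.End.one_apply, e3, hk]
  abel

theorem SES.det_lap (h : SES i p) (T : K →ₗ[ℂ] K) :
    LinearMap.det (LinearMap.adjoint p ∘ₗ p + i ∘ₗ T ∘ₗ LinearMap.adjoint i) =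
      LinearMap.det (p ∘ₗ LinearMap.adjoint p) * LinearMap.det T := by
  obtain ⟨R, h1, h2, h3⟩ := h.exists_R
  have e : LinearMap.adjoint p ∘ₗ p + i ∘ₗ T ∘ₗ LinearMap.adjoint i =
      (1 + LinearMap.adjoint p ∘ₗ ((1 - R) ∘ₗ p)) ∘ₗ (1 + i ∘ₗ ((T - 1) ∘ₗ LinearMap.adjoint i)) := by
    ext x
    have a1 := LinearMap.congr_fun h3 x
    have a2 : ∀ k, p (i k) = 0 := fun k => LinearMap.congr_fun h.pi k
    simp only [LinearMap.add_apply, LinearMap.comp_apply, Module.End.one_apply,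
      LinearMap.sub_apply, map_add, map_sub, a2] at a1 ⊢
    nth_rewrite 3 [← a1]
    simp
    abel
  rw [e, LinearMap.det_comp, det_one_add_comm (LinearMap.adjoint p), det_one_add_comm i]
  congr 2
  · rw [LinearMap.comp_assoc, LinearMap.sub_comp, h2]
    change 1 + ((p ∘ₗ LinearMap.adjoint p) - 1) = _
    abel
  · rw [LinearMap.comp_assoc, h.iso]
    change 1 + (T - 1) = _
    abel

theorem SES.det_jacobi (h : SES i p) (H G : E →ₗ[ℂ] E) (hHG : H ∘ₗ G = 1) :
    LinearMap.det (LinearMap.adjoint i ∘ₗ H ∘ₗ i) * LinearMap.det (p ∘ₗ LinearMap.adjoint p) =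
      LinearMap.det H * LinearMap.det (p ∘ₗ G ∘ₗ LinearMap.adjoint p) := by
  obtain ⟨R, h1, h2, h3⟩ := h.exists_R
  have e : 1 + ((H - 1) ∘ₗ i) ∘ₗ LinearMap.adjoint i =
      H ∘ₗ (1 + ((G - 1) ∘ₗ LinearMap.adjoint p) ∘ₗ (R ∘ₗ p)) := by
    ext x
    have a1 := LinearMap.congr_fun h3 x
    have a2 : ∀ k, H (G k) = k := fun k => LinearMap.congr_fun hHG k
    simp only [LinearMap.add_apply, LinearMap.comp_apply, Module.End.one_apply,
      LinearMap.sub_apply, map_add, map_sub, a2] at a1 ⊢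
    have a3 := congrArg H a1
    rw [map_add] at a3
    rw [← a3]
    nth_rewrite 1 [← a1]
    abel
  have e' := congrArg LinearMap.det e
  rw [LinearMap.det_comp, det_one_add_comm _ (LinearMap.adjoint i), det_one_add_comm _ (R ∘ₗ p)] at e'
  have f1 : 1 + LinearMap.adjoint i ∘ₗ ((H - 1) ∘ₗ i) = LinearMap.adjoint i ∘ₗ H ∘ₗ i := by
    rw [LinearMap.sub_comp, LinearMap.comp_sub]
    change 1 + (_ - (LinearMap.adjoint i ∘ₗ i)) = _
    rw [h.iso]; abel
  have f2 : 1 + (R ∘ₗ p) ∘ₗ ((G - 1) ∘ₗ LinearMap.adjoint p) =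
      R ∘ₗ (p ∘ₗ G ∘ₗ LinearMap.adjoint p) := by
    rw [LinearMap.sub_comp, LinearMap.comp_sub]
    change 1 + (_ - (R ∘ₗ (p ∘ₗ LinearMap.adjoint p))) = _
    rw [h2]; 
    change 1 + (R ∘ₗ (p ∘ₗ G ∘ₗ LinearMap.adjoint p) - 1) = _
    abel
  rw [f1, f2, LinearMap.det_comp] at e'
  have f3 := congrArg LinearMap.det h2
  rw [LinearMap.det_comp, map_one] at f3
  rw [e']
  linear_combination (LinearMap.det H * LinearMap.det (p ∘ₗ G ∘ₗ LinearMap.adjoint p)) * f3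

/-- Behaviour of the determinants under change of inner products. -/
theorem SES.det_change (h : SES i p) {i' : K' →ₗ[ℂ] E'} {p' : E' →ₗ[ℂ] L'}
    (hi' : LinearMap.adjoint i' ∘ₗ i' = 1)
    (k : K →ₗ[ℂ] K') (g : E ≃ₗ[ℂ] E') (l : L ≃ₗ[ℂ] L')
    (hk : i' ∘ₗ k = g.toLinearMap ∘ₗ i) (hl : p' ∘ₗ g.toLinearMap = l.toLinearMap ∘ₗ p) :
    LinearMap.det (p' ∘ₗ LinearMap.adjoint p') *
        LinearMap.det (LinearMap.adjoint g.toLinearMap ∘ₗ g.toLinearMap) =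
      LinearMap.det (p ∘ₗ LinearMap.adjoint p) * LinearMap.det (LinearMap.adjoint k ∘ₗ k) *
        LinearMap.det (LinearMap.adjoint l.toLinearMap ∘ₗ l.toLinearMap) := by
  set g0 := g.toLinearMap with hg0
  set g1 := g.symm.toLinearMap with hg1
  set l0 := l.toLinearMap with hl0
  have gg : g0 ∘ₗ g1 = LinearMap.id := by ext x; simp [g0, g1]
  have gg' : LinearMap.adjoint g0 ∘ₗ LinearMap.adjoint g1 = LinearMap.id := by
    rw [← LinearMap.adjoint_comp]
    have : g1 ∘ₗ g0 = LinearMap.id := by ext x; simp [g0, g1]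
    rw [this, LinearMap.adjoint_id]
  have hHG : (LinearMap.adjoint g0 ∘ₗ g0) ∘ₗ (g1 ∘ₗ LinearMap.adjoint g1) = 1 := by
    rw [LinearMap.comp_assoc, ← LinearMap.comp_assoc _ g1 g0, gg, LinearMap.id_comp, gg']; rfl
  have J := h.det_jacobi _ _ hHG
  have ek : LinearMap.adjoint i ∘ₗ (LinearMap.adjoint g0 ∘ₗ g0) ∘ₗ i = LinearMap.adjoint k ∘ₗ k := by
    have : LinearMap.adjoint (i' ∘ₗ k) ∘ₗ (i' ∘ₗ k) = LinearMap.adjoint k ∘ₗ k := by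
      rw [LinearMap.adjoint_comp, LinearMap.comp_assoc, ← LinearMap.comp_assoc k i', hi']; rfl
    rw [← this, hk, LinearMap.adjoint_comp]; rfl
  have ep : p' = l0 ∘ₗ p ∘ₗ g1 := by
    rw [← LinearMap.comp_assoc, ← hl, LinearMap.comp_assoc, gg, LinearMap.comp_id]
  have ed : LinearMap.det (p' ∘ₗ LinearMap.adjoint p') =
      LinearMap.det (p ∘ₗ (g1 ∘ₗ LinearMap.adjoint g1) ∘ₗ LinearMap.adjoint p) *
        LinearMap.det (LinearMap.adjoint l0 ∘ₗ l0) := by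
    rw [← LinearMap.det_comp, ← LinearMap.det_conj _ l]
    congr 1
    rw [ep]
    ext x
    simp [LinearMap.adjoint_comp, l0]
  rw [ek] at J
  rw [ed]
  linear_combination (-LinearMap.det (LinearMap.adjoint l0 ∘ₗ l0)) * J

/-- Orthogonal direct sum of two linear maps. -/
def pm (A : E →ₗ[ℂ] E') (B : K →ₗ[ℂ] K') : WithLp 2 (E × K) →ₗ[ℂ] WithLp 2 (E' × K') :=
  (WithLp.linearEquiv 2 ℂ (E' × K')).symm.toLinearMap ∘ₗ A.prodMap B ∘ₗ
    (WithLp.linearEquiv 2 ℂ (E × K)).toLinearMap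

theorem pm_apply (A : E →ₗ[ℂ] E') (B : K →ₗ[ℂ] K') (x : WithLp 2 (E × K)) :
    pm A B x = WithLp.toLp 2 (A x.fst, B x.snd) := rfl

theorem pm_comp (A' : E' →ₗ[ℂ] L) (B' : K' →ₗ[ℂ] L') (A : E →ₗ[ℂ] E') (B : K →ₗ[ℂ] K') :
    pm A' B' ∘ₗ pm A B = pm (A' ∘ₗ A) (B' ∘ₗ B) := rfl

theorem pm_add (A A' : E →ₗ[ℂ] E') (B B' : K →ₗ[ℂ] K') :
    pm A B + pm A' B' = pm (A + A') (B + B') := rfl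

theorem pm_adjoint (A : E →ₗ[ℂ] E') (B : K →ₗ[ℂ] K') :
    LinearMap.adjoint (pm A B) = pm (LinearMap.adjoint A) (LinearMap.adjoint B) := by
  symm
  rw [LinearMap.eq_adjoint_iff]
  intro x y
  simp [pm_apply, WithLp.prod_inner_apply, LinearMap.adjoint_inner_left]

theorem pm_det (A : E →ₗ[ℂ] E) (B : K →ₗ[ℂ] K) :
    LinearMap.det (pm A B) = LinearMap.det A * LinearMap.det B := by
  rw [← LinearMap.det_prodMap, ← LinearMap.det_conj _ (WithLp.linearEquiv 2 ℂ (E × K)).symm]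
  rfl

/-- The unipotent map `(u, v) ↦ (u + h v, v)`. -/
def uni (h : K →ₗ[ℂ] E) : WithLp 2 (E × K) ≃ₗ[ℂ] WithLp 2 (E × K) :=
  LinearEquiv.ofLinearMap
    (1 + ((WithLp.linearEquiv 2 ℂ (E × K)).symm.toLinearMap ∘ₗ LinearMap.inl ℂ E K ∘ₗ h) ∘ₗ
      (LinearMap.snd ℂ E K ∘ₗ (WithLp.linearEquiv 2 ℂ (E × K)).toLinearMap))
    (1 - ((WithLp.linearEquiv 2 ℂ (E × K)).symm.toLinearMap ∘ₗ LinearMap.inl ℂ E K ∘ₗ h) ∘ₗ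
      (LinearMap.snd ℂ E K ∘ₗ (WithLp.linearEquiv 2 ℂ (E × K)).toLinearMap))
    (by ext x; simp) (by ext x; simp)

theorem uni_apply (h : K →ₗ[ℂ] E) (u : E) (v : K) :
    uni h (WithLp.toLp 2 (u, v)) = WithLp.toLp 2 (u + h v, v) := by
  simp [uni]
  rw [← WithLp.toLp_add]; simp

theorem uni_det (h : K →ₗ[ℂ] E) : LinearMap.det (uni h).toLinearMap = 1 := by
  unfold uni
  rw [LinearEquiv.toLinearMap_ofLinearMap, det_one_add_comm]
  convert map_one (LinearMap.det (A := ℂ) (M := K))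
  ext x; simp

end Abstract

end TorsionAux

namespace TorsionAux

section Complex

variable {N : ℕ}

/-- The differential as a map onto the cocycles. -/
def del (X : FinComplex N) (q : ℕ) : X.C q →ₗ[ℂ] LinearMap.ker (X.d (q + 1)) :=
  (X.d q).codRestrict _ (fun x => by
    rw [LinearMap.mem_ker]; exact LinearMap.congr_fun (X.dd q) x)

theorem subtype_del (X : FinComplex N) (q : ℕ) :
    (LinearMap.ker (X.d (q + 1))).subtype ∘ₗ del X q = X.d q := rfl

theorem ses (X : FinComplex N) (hX : X.Acyclic) (q : ℕ) :
    SES (LinearMap.ker (X.d q)).subtype (del X q) where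
  iso := by
    ext x
    refine congrArg Subtype.val (a₂ := x) ?_
    refine ext_inner_right ℂ (fun y => ?_)
    rw [LinearMap.comp_apply, LinearMap.adjoint_inner_left]
    rfl
  ex := by
    rw [del, LinearMap.ker_codRestrict, Submodule.range_subtype]
  surj := by
    rw [LinearMap.range_eq_top]
    rintro ⟨y, hy⟩
    rw [hX.2 q] at hy
    obtain ⟨x, rfl⟩ := hy
    exact ⟨x, rfl⟩

/-- Determinant of `d d^*` on cocycles. -/
def av (X : FinComplex N) : ℕ → ℂ
  | 0 => 1
  | (q + 1) => LinearMap.det (del X q ∘ₗ LinearMap.adjoint (del X q))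

theorem av_ne (X : FinComplex N) (hX : X.Acyclic) (q : ℕ) : av X q ≠ 0 := by
  cases q with
  | zero => exact one_ne_zero
  | succ q => exact (ses X hX q).det_ne

theorem ker_subsingleton_zero (X : FinComplex N) (hX : X.Acyclic) :
    Subsingleton (LinearMap.ker (X.d 0)) := by
  rw [hX.1]; infer_instance

theorem ker_subsingleton_top (X : FinComplex N) : Subsingleton (LinearMap.ker (X.d (N + 1))) :=
  ⟨fun a b => Subtype.ext (by
    rw [X.trivial_beyond (N + 1) (Nat.lt_succ_self N) a.1,
      X.trivial_beyond (N + 1) (Nat.lt_succ_self N) b.1])⟩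

theorem av_top (X : FinComplex N) : av X (N + 1) = 1 := by
  have := ker_subsingleton_top X
  exact LinearMap.det_eq_one_of_subsingleton _

theorem adj_comp_self_d (X : FinComplex N) (hX : X.Acyclic) (q : ℕ) :
    LinearMap.adjoint (X.d q) ∘ₗ X.d q = LinearMap.adjoint (del X q) ∘ₗ del X q := by
  rw [← subtype_del X q, LinearMap.adjoint_comp, LinearMap.comp_assoc,
    ← LinearMap.comp_assoc (del X q), (ses X hX (q + 1)).iso]
  rfl

theorem det_lap (X : FinComplex N) (hX : X.Acyclic) (q : ℕ) :
    LinearMap.det (X.lap q) = av X (q + 1) * av X q := by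
  cases q with
  | zero =>
    have h := (ses X hX 0).det_lap 0
    have := ker_subsingleton_zero X hX
    rw [LinearMap.det_eq_one_of_subsingleton (0 : LinearMap.ker (X.d 0) →ₗ[ℂ] _)] at h
    rw [FinComplex.lap, av, av, ← h, adj_comp_self_d X hX]
    simp
  | succ q =>
    have h := (ses X hX (q + 1)).det_lap (del X q ∘ₗ LinearMap.adjoint (del X q))
    rw [FinComplex.lap, av, av, ← h, adj_comp_self_d X hX]
    congr 2
    conv_lhs => rw [← subtype_del X q, LinearMap.adjoint_comp]
    rfl

theorem lap_adj (X : FinComplex N) (q : ℕ) : LinearMap.adjoint (X.lap q) = X.lap q := by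
  cases q <;> simp [FinComplex.lap, LinearMap.adjoint_comp]

theorem log_re (X : FinComplex N) (q : ℕ) :
    Real.log ((LinearMap.det (X.lap q)).re) = Real.log ‖LinearMap.det (X.lap q)‖ := by
  have h := det_adj (X.lap q)
  rw [lap_adj] at h
  obtain ⟨r, hr⟩ := Complex.conj_eq_iff_real.1 h.symm
  rw [hr, Complex.ofReal_re, Complex.norm_real, Real.norm_eq_abs, Real.log_abs]

theorem log_lap (X : FinComplex N) (hX : X.Acyclic) (q : ℕ) :
    Real.log ((LinearMap.det (X.lap q)).re) =
      Real.log ‖av X (q + 1)‖ + Real.log ‖av X q‖ := by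
  rw [log_re, det_lap X hX, norm_mul, Real.log_mul]
  · exact norm_ne_zero_iff.2 (av_ne X hX _)
  · exact norm_ne_zero_iff.2 (av_ne X hX _)

theorem alt_sum (b k : ℕ → ℝ) (hk : k 0 = 0)
    (h : ∀ q, b (q + 1) = k q + k (q + 1)) (n : ℕ) :
    ∑ q ∈ Finset.range (n + 1), (-1 : ℝ) ^ (q + 1) * (q : ℝ) * (b (q + 1) + b q) =
      (-1) ^ (n + 1) * (n * b (n + 1) + k n) := by
  induction n with
  | zero => simp [hk]
  | succ n ih =>
    rw [Finset.sum_range_succ, ih, h n, h (n + 1)]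
    push_cast
    ring

theorem ker_map {X Y : FinComplex N} (g : ∀ q, X.C q ≃ₗ[ℂ] Y.C q)
    (hg : ∀ q x, Y.d q (g q x) = g (q + 1) (X.d q x)) (q : ℕ) :
    (LinearMap.ker (X.d q)).map (g q).toLinearMap = LinearMap.ker (Y.d q) := by
  ext y
  constructor
  · rintro ⟨x, hx, rfl⟩
    have hx' : X.d q x = 0 := hx
    rw [LinearMap.mem_ker, LinearEquiv.coe_coe, hg, hx', map_zero]
  · intro hy
    refine ⟨(g q).symm y, ?_, by simp⟩
    have hy' : Y.d q y = 0 := hy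
    have := hg q ((g q).symm y)
    rw [LinearEquiv.apply_symm_apply, hy'] at this
    exact (g (q + 1)).injective (by rw [← this, map_zero])

theorem acyclic_of_equiv {X Y : FinComplex N} (hX : X.Acyclic) (g : ∀ q, X.C q ≃ₗ[ℂ] Y.C q)
    (hg : ∀ q x, Y.d q (g q x) = g (q + 1) (X.d q x)) : Y.Acyclic := by
  refine ⟨?_, fun q => ?_⟩
  · rw [← ker_map g hg, hX.1, Submodule.map_bot]
  · rw [← ker_map g hg, hX.2]
    ext y
    constructor
    · rintro ⟨_, ⟨x, rfl⟩, rfl⟩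
      exact ⟨g q x, hg q x⟩
    · rintro ⟨x, rfl⟩
      refine ⟨X.d q ((g q).symm x), ⟨_, rfl⟩, ?_⟩
      rw [LinearEquiv.coe_coe, ← hg, LinearEquiv.apply_symm_apply]

/-- Invariance of torsion under unimodular isomorphisms of complexes. -/
theorem logT_of_equiv {X Y : FinComplex N} (hX : X.Acyclic) (g : ∀ q, X.C q ≃ₗ[ℂ] Y.C q)
    (hg : ∀ q x, Y.d q (g q x) = g (q + 1) (X.d q x))
    (hdet : ∀ q, LinearMap.det (LinearMap.adjoint (g q).toLinearMap ∘ₗ (g q).toLinearMap) = 1) :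
    Y.logT = X.logT := by
  have hY := acyclic_of_equiv hX g hg
  let γ : ∀ q, LinearMap.ker (X.d q) ≃ₗ[ℂ] LinearMap.ker (Y.d q) := fun q =>
    (g q).ofSubmodules _ _ (ker_map g hg q)
  let κ : ℕ → ℂ := fun q => LinearMap.det (LinearMap.adjoint (γ q).toLinearMap ∘ₗ (γ q).toLinearMap)
  have hκ : ∀ q, av Y (q + 1) = av X (q + 1) * κ q * κ (q + 1) := by
    intro q
    have := (ses X hX q).det_change (p' := del Y q) (ses Y hY q).iso (γ q).toLinearMap (g q)
      (γ (q + 1)) rfl (by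
        ext x
        exact hg q x)
    rw [hdet, mul_one] at this
    exact this
  have hne : ∀ q, κ q ≠ 0 := by
    intro q h0
    have := hκ q
    rw [h0, mul_zero, zero_mul] at this
    exact av_ne Y hY _ this
  let b : ℕ → ℝ := fun q => Real.log ‖av Y q‖ - Real.log ‖av X q‖
  let k : ℕ → ℝ := fun q => Real.log ‖κ q‖
  have hk0 : k 0 = 0 := by
    have := ker_subsingleton_zero X hX
    simp only [k, κ]
    rw [LinearMap.det_eq_one_of_subsingleton]; simp
  have hkN : k (N + 1) = 0 := by
    have := ker_subsingleton_top X
    simp only [k, κ]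
    rw [LinearMap.det_eq_one_of_subsingleton]; simp
  have hbN : b (N + 1) = 0 := by simp [b, av_top]
  have hbk : ∀ q, b (q + 1) = k q + k (q + 1) := by
    intro q
    simp only [b, k]
    rw [hκ q, norm_mul, norm_mul, Real.log_mul, Real.log_mul]
    · ring
    · exact norm_ne_zero_iff.2 (av_ne X hX _)
    · exact norm_ne_zero_iff.2 (hne _)
    · exact mul_ne_zero (norm_ne_zero_iff.2 (av_ne X hX _)) (norm_ne_zero_iff.2 (hne _))
    · exact norm_ne_zero_iff.2 (hne _)
  have hs := alt_sum b k hk0 hbk N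
  have hkN' : k N = 0 := by
    have := hbk N
    rw [hbN, hkN] at this; linarith
  rw [hbN, hkN', mul_zero, add_zero, mul_zero] at hs
  unfold FinComplex.logT
  congr 1
  rw [← sub_eq_zero, ← Finset.sum_sub_distrib, ← hs]
  refine Finset.sum_congr rfl (fun q _ => ?_)
  rw [log_lap X hX, log_lap Y hY]
  simp only [b]
  ring

/-- Orthogonal direct sum of complexes. -/
def dsum (X1 X2 : FinComplex N) : FinComplex N where
  C := fun q => WithLp 2 (X1.C q × X2.C q)
  d := fun q => pm (X1.d q) (X2.d q)
  dd := fun q => by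
    rw [pm_comp, X1.dd, X2.dd]; rfl
  trivial_beyond := fun q hq x => by
    have e1 := X1.trivial_beyond q hq x.fst
    have e2 := X2.trivial_beyond q hq x.snd
    apply (WithLp.equiv 2 _).injective
    exact Prod.ext e1 e2

theorem dsum_acyclic {X1 X2 : FinComplex N} (h1 : X1.Acyclic) (h2 : X2.Acyclic) :
    (dsum X1 X2).Acyclic := by
  refine ⟨?_, fun q => ?_⟩
  · rw [LinearMap.ker_eq_bot']
    intro x hx
    have hx' : WithLp.toLp 2 (X1.d 0 x.fst, X2.d 0 x.snd) = (0 : WithLp 2 (X1.C 1 × X2.C 1)) := hx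
    have a1 : X1.d 0 x.fst = 0 := congrArg WithLp.fst hx'
    have a2 : X2.d 0 x.snd = 0 := congrArg WithLp.snd hx'
    apply (WithLp.equiv 2 _).injective
    exact Prod.ext (LinearMap.ker_eq_bot'.1 h1.1 _ a1) (LinearMap.ker_eq_bot'.1 h2.1 _ a2)
  · apply le_antisymm
    · intro x hx
      have hx' : WithLp.toLp 2 (X1.d (q + 1) x.fst, X2.d (q + 1) x.snd) =
        (0 : WithLp 2 (X1.C (q + 2) × X2.C (q + 2))) := hx
      have a1 : x.fst ∈ LinearMap.ker (X1.d (q + 1)) := congrArg WithLp.fst hx'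
      have a2 : x.snd ∈ LinearMap.ker (X2.d (q + 1)) := congrArg WithLp.snd hx'
      rw [h1.2] at a1
      rw [h2.2] at a2
      obtain ⟨u, hu⟩ := a1
      obtain ⟨v, hv⟩ := a2
      refine ⟨WithLp.toLp 2 (u, v), ?_⟩
      apply (WithLp.equiv 2 _).injective
      exact Prod.ext hu hv
    · rintro _ ⟨x, rfl⟩
      exact LinearMap.congr_fun ((dsum X1 X2).dd q) x

theorem dsum_lap (X1 X2 : FinComplex N) (q : ℕ) :
    (dsum X1 X2).lap q = pm (X1.lap q) (X2.lap q) := by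
  cases q with
  | zero =>
    change LinearMap.adjoint (pm (X1.d 0) (X2.d 0)) ∘ₗ pm (X1.d 0) (X2.d 0) = _
    rw [pm_adjoint, pm_comp]; rfl
  | succ q =>
    change LinearMap.adjoint (pm (X1.d (q + 1)) (X2.d (q + 1))) ∘ₗ
      pm (X1.d (q + 1)) (X2.d (q + 1)) +
      pm (X1.d q) (X2.d q) ∘ₗ LinearMap.adjoint (pm (X1.d q) (X2.d q)) = _
    rw [pm_adjoint, pm_adjoint, pm_comp, pm_comp, pm_add]; rfl

theorem dsum_logT {X1 X2 : FinComplex N} (h1 : X1.Acyclic) (h2 : X2.Acyclic) :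
    (dsum X1 X2).logT = X1.logT + X2.logT := by
  unfold FinComplex.logT
  rw [← mul_add, ← Finset.sum_add_distrib]
  congr 1
  refine Finset.sum_congr rfl (fun q _ => ?_)
  rw [log_re, log_re, log_re, dsum_lap]
  have e : LinearMap.det (pm (X1.lap q) (X2.lap q)) = _ := pm_det _ _
  rw [← mul_add, ← Real.log_mul, ← norm_mul]
  · exact congrArg (fun z : ℂ => (-1 : ℝ) ^ (q + 1) * (q : ℝ) * Real.log ‖z‖) e
  · rw [det_lap X1 h1]
    exact norm_ne_zero_iff.2 (mul_ne_zero (av_ne X1 h1 _) (av_ne X1 h1 _))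
  · rw [det_lap X2 h2]
    exact norm_ne_zero_iff.2 (mul_ne_zero (av_ne X2 h2 _) (av_ne X2 h2 _))

theorem exists_ginv {V W : Type*} [AddCommGroup V] [Module ℂ V] [AddCommGroup W] [Module ℂ W]
    (d : V →ₗ[ℂ] W) : ∃ t : W →ₗ[ℂ] V, ∀ x, d (t (d x)) = d x := by
  obtain ⟨r, hr⟩ := d.rangeRestrict.exists_rightInverse_of_surjective d.range_rangeRestrict
  obtain ⟨s, hs⟩ := (LinearMap.range d).subtype.exists_leftInverse_of_injective
    (Submodule.ker_subtype _)
  refine ⟨r ∘ₗ s, fun x => ?_⟩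
  have e1 : s (d x) = d.rangeRestrict x := LinearMap.congr_fun hs (d.rangeRestrict x)
  have e2 := LinearMap.congr_fun hr (d.rangeRestrict x)
  rw [LinearMap.comp_apply, e1]
  exact congrArg Subtype.val e2

theorem exists_contraction (X : FinComplex N) (hX : X.Acyclic) :
    ∃ s : ∀ q, X.C (q + 1) →ₗ[ℂ] X.C q,
      ∀ q x, s (q + 1) (X.d (q + 1) x) + X.d q (s q x) = x := by
  choose t ht using fun q => exists_ginv (X.d q)
  refine ⟨fun q => t q ∘ₗ (1 - t (q + 1) ∘ₗ X.d (q + 1)), fun q x => ?_⟩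
  have hm : x - t (q + 1) (X.d (q + 1) x) ∈ LinearMap.ker (X.d (q + 1)) := by
    rw [LinearMap.mem_ker, map_sub, ht, sub_self]
  rw [hX.2] at hm
  obtain ⟨y, hy⟩ := hm
  have dd : X.d (q + 1 + 1) (X.d (q + 1) x) = 0 := LinearMap.congr_fun (X.dd (q + 1)) x
  simp only [LinearMap.comp_apply, LinearMap.sub_apply, Module.End.one_apply, dd, map_zero,
    sub_zero, ← hy, ht]
  rw [hy]; abel

end Complex

end TorsionAux

open FinComplex in
/-- **Lemma of Carey–Mathai–Mishchenko (Lemma 1.14 of [BFK, "Relative torsion"])** in the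
finite-dimensional case `𝒜 = ℂ`.  If `X1`, `X2` are acyclic cochain complexes of
finite-dimensional complex inner product spaces and `f_i : X2_i → X1_{i+1}` satisfy
`f_{i+1} d_{2,i} + d_{1,i+1} f_i = 0`, then the complex `Z` with `Z_i = X1_i ⊕ X2_i`
(orthogonal direct sum) and `d_i (u,v) = (d_{1,i} u + f_i v, d_{2,i} v)` is an acyclic
cochain complex and `log T(Z) = log T(X1) + log T(X2)`. -/
theorem torsion_twisted_sum (N : ℕ) (X1 X2 : FinComplex N)
    (h1 : X1.Acyclic) (h2 : X2.Acyclic)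
    (f : ∀ q, X2.C q →ₗ[ℂ] X1.C (q + 1))
    (hf : ∀ q (v : X2.C q), f (q + 1) (X2.d q v) + X1.d (q + 1) (f q v) = 0)
    (Z : FinComplex N)
    (e : ∀ q, WithLp 2 (X1.C q × X2.C q) ≃ₗᵢ[ℂ] Z.C q)
    (he : ∀ q (u : X1.C q) (v : X2.C q),
      Z.d q (e q ((WithLp.equiv 2 (X1.C q × X2.C q)).symm (u, v))) =
        e (q + 1) ((WithLp.equiv 2 (X1.C (q + 1) × X2.C (q + 1))).symm
          (X1.d q u + f q v, X2.d q v))) :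
    Z.Acyclic ∧ Z.logT = X1.logT + X2.logT := by
  obtain ⟨s, hs⟩ := TorsionAux.exists_contraction X1 h1
  let h : ∀ q, X2.C q →ₗ[ℂ] X1.C q := fun q => -(s q ∘ₗ f q)
  have hh : ∀ q (v : X2.C q), h (q + 1) (X2.d q v) = X1.d q (h q v) + f q v := by
    intro q v
    have a := hs q (f q v)
    have b : f (q + 1) (X2.d q v) = - X1.d (q + 1) (f q v) := eq_neg_of_add_eq_zero_left (hf q v)
    simp only [h, LinearMap.neg_apply, LinearMap.comp_apply, b, map_neg, neg_neg]
    nth_rewrite 3 [← a]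
    abel
  let g : ∀ q, (TorsionAux.dsum X1 X2).C q ≃ₗ[ℂ] Z.C q := fun q =>
    (TorsionAux.uni (h q)).trans (e q).toLinearEquiv
  have hg : ∀ q x, Z.d q (g q x) = g (q + 1) ((TorsionAux.dsum X1 X2).d q x) := by
    intro q x
    have a1 : TorsionAux.uni (h q) x = WithLp.toLp 2 (x.fst + h q x.snd, x.snd) :=
      TorsionAux.uni_apply (h q) x.fst x.snd
    have a2 : TorsionAux.uni (h (q + 1)) ((TorsionAux.dsum X1 X2).d q x) =
        WithLp.toLp 2 (X1.d q x.fst + h (q + 1) (X2.d q x.snd), X2.d q x.snd) :=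
      TorsionAux.uni_apply (h (q + 1)) (X1.d q x.fst) (X2.d q x.snd)
    change Z.d q (e q (TorsionAux.uni (h q) x)) =
      e (q + 1) (TorsionAux.uni (h (q + 1)) ((TorsionAux.dsum X1 X2).d q x))
    rw [a1, a2]
    refine (he q _ _).trans ?_
    rw [hh, map_add, add_assoc]
    rfl
  have hd : (TorsionAux.dsum X1 X2).Acyclic := TorsionAux.dsum_acyclic h1 h2
  refine ⟨TorsionAux.acyclic_of_equiv hd g hg, ?_⟩
  rw [← TorsionAux.dsum_logT h1 h2]
  refine TorsionAux.logT_of_equiv hd g hg (fun q => ?_)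
  have hu : LinearMap.det (LinearMap.adjoint (TorsionAux.uni (h q)).toLinearMap ∘ₗ
      (TorsionAux.uni (h q)).toLinearMap) = 1 := by
    rw [LinearMap.det_comp, TorsionAux.det_adj, TorsionAux.uni_det]; simp
  refine Eq.trans ?_ hu
  congr 1
  refine LinearMap.ext fun x => ext_inner_right ℂ (fun y => ?_)
  rw [LinearMap.comp_apply, LinearMap.adjoint_inner_left]
  refine Eq.trans ((e q).inner_map_map (TorsionAux.uni (h q) x) (TorsionAux.uni (h q) y)) ?_
  exact (LinearMap.adjoint_inner_left (TorsionAux.uni (h q)).toLinearMap y _).symm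
end
end

section
/- Let C¹, C², C³ be cochain complexes of finite-dimensional complex inner product spaces, and let f₁ : C¹ → C² and f₂ : C² → C³ be morphisms of complexes, each inducing an isomorphism in cohomology. Then the mapping cones C(f₁), C(f₂) and C(f₂ ∘ f₁) are acyclic cochain complexes, and log T(C(f₂ ∘ f₁)) = log T(C(f₁)) + log T(C(f₂)). -/
noncomputable section

open LinearMap

set_option linter.unusedSectionVars false
set_option linter.unusedSimpArgs false

namespace TC

section LinAlg

variable {E F G E' F' : Type}
  [NormedAddCommGroup E] [InnerProductSpace ℂ E] [FiniteDimensional ℂ E]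
  [NormedAddCommGroup F] [InnerProductSpace ℂ F] [FiniteDimensional ℂ F]
  [NormedAddCommGroup G] [InnerProductSpace ℂ G] [FiniteDimensional ℂ G]
  [NormedAddCommGroup E'] [InnerProductSpace ℂ E'] [FiniteDimensional ℂ E']
  [NormedAddCommGroup F'] [InnerProductSpace ℂ F'] [FiniteDimensional ℂ F']

/-- The map into an orthogonal direct sum with given components. -/
def sumL (a : G →ₗ[ℂ] E) (b : G →ₗ[ℂ] F) : G →ₗ[ℂ] WithLp 2 (E × F) :=
  (WithLp.linearEquiv 2 ℂ (E × F)).symm.toLinearMap ∘ₗ a.prod b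

@[simp] lemma sumL_apply (a : G →ₗ[ℂ] E) (b : G →ₗ[ℂ] F) (x : G) :
    sumL a b x = WithLp.toLp 2 (a x, b x) := rfl

/-- First projection. -/
def p1 : WithLp 2 (E × F) →ₗ[ℂ] E :=
  LinearMap.fst ℂ E F ∘ₗ (WithLp.linearEquiv 2 ℂ (E × F)).toLinearMap

/-- Second projection. -/
def p2 : WithLp 2 (E × F) →ₗ[ℂ] F :=
  LinearMap.snd ℂ E F ∘ₗ (WithLp.linearEquiv 2 ℂ (E × F)).toLinearMap

@[simp] lemma p1_apply (x : WithLp 2 (E × F)) : p1 x = x.fst := rfl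
@[simp] lemma p2_apply (x : WithLp 2 (E × F)) : p2 x = x.snd := rfl

lemma toLp_eta (x : WithLp 2 (E × F)) : WithLp.toLp 2 (x.fst, x.snd) = x := rfl

lemma lp_ext {x y : WithLp 2 (E × F)} (h1 : x.fst = y.fst) (h2 : x.snd = y.snd) :
    x = y := by
  rw [← toLp_eta x, ← toLp_eta y, h1, h2]

/-- Direct sum of maps. -/
def pr (g : E →ₗ[ℂ] E') (h : F →ₗ[ℂ] F') : WithLp 2 (E × F) →ₗ[ℂ] WithLp 2 (E' × F') :=
  sumL (g ∘ₗ p1) (h ∘ₗ p2)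

@[simp] lemma pr_apply (g : E →ₗ[ℂ] E') (h : F →ₗ[ℂ] F') (x : WithLp 2 (E × F)) :
    pr g h x = WithLp.toLp 2 (g x.fst, h x.snd) := rfl

lemma adjoint_pr (g : E →ₗ[ℂ] E') (h : F →ₗ[ℂ] F') :
    LinearMap.adjoint (pr g h) = pr (LinearMap.adjoint g) (LinearMap.adjoint h) := by
  symm
  rw [LinearMap.eq_adjoint_iff]
  intro x y
  simp [WithLp.prod_inner_apply, LinearMap.adjoint_inner_left]

lemma det_pr (g : E →ₗ[ℂ] E) (h : F →ₗ[ℂ] F) :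
    LinearMap.det (pr g h) = LinearMap.det g * LinearMap.det h := by
  rw [← LinearMap.det_prodMap, ← LinearMap.det_conj _ (WithLp.linearEquiv 2 ℂ (E × F)).symm]
  rfl

lemma normDet_pr (g : E →ₗ[ℂ] E') (h : F →ₗ[ℂ] F') :
    (pr g h).normDet = g.normDet * h.normDet := by
  have h1 := (pr g h).normDet_sq
  have h2 : LinearMap.adjoint (pr g h) ∘ₗ pr g h
      = pr (LinearMap.adjoint g ∘ₗ g) (LinearMap.adjoint h ∘ₗ h) := by
    rw [adjoint_pr]; rfl
  rw [h2, det_pr, ← LinearMap.normDet_sq, ← LinearMap.normDet_sq, ← RCLike.ofReal_mul,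
    ← mul_pow] at h1
  have h3 := RCLike.ofReal_injective h1
  exact (sq_eq_sq₀ (LinearMap.normDet_nonneg _)
    (mul_nonneg (LinearMap.normDet_nonneg _) (LinearMap.normDet_nonneg _))).1 h3

lemma normDet_comp_bij (g : F →ₗ[ℂ] G) (h : E →ₗ[ℂ] F) (hh : Function.Bijective h) :
    (g ∘ₗ h).normDet = g.normDet * h.normDet :=
  LinearMap.normDet_comp_of_finrank_eq h g (LinearEquiv.ofBijective h hh).finrank_eq

lemma normDet_pos (g : E →ₗ[ℂ] F) (hg : Function.Injective g) : 0 < g.normDet := by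
  refine lt_of_le_of_ne g.normDet_nonneg (Ne.symm ?_)
  intro h
  rw [LinearMap.normDet_eq_zero_iff_ker_ne_bot] at h
  exact h (LinearMap.ker_eq_bot.2 hg)

lemma normDet_isom (e : E ≃ₗᵢ[ℂ] F) : e.toLinearEquiv.toLinearMap.normDet = 1 :=
  e.toLinearIsometry.normDet_eq_one

/-- Lower unipotent map. -/
def uL (t : E →ₗ[ℂ] F) : WithLp 2 (E × F) →ₗ[ℂ] WithLp 2 (E × F) :=
  sumL p1 (p2 + t ∘ₗ p1)

@[simp] lemma uL_apply (t : E →ₗ[ℂ] F) (x : WithLp 2 (E × F)) :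
    uL t x = WithLp.toLp 2 (x.fst, x.snd + t x.fst) := rfl

/-- Upper unipotent map. -/
def uU (t : F →ₗ[ℂ] E) : WithLp 2 (E × F) →ₗ[ℂ] WithLp 2 (E × F) :=
  sumL (p1 + t ∘ₗ p2) p2

@[simp] lemma uU_apply (t : F →ₗ[ℂ] E) (x : WithLp 2 (E × F)) :
    uU t x = WithLp.toLp 2 (x.fst + t x.snd, x.snd) := rfl

lemma det_ne_zero_of_comp {f g : E →ₗ[ℂ] E} (h : f ∘ₗ g = LinearMap.id) :
    LinearMap.det f ≠ 0 := by
  intro h0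
  have := congrArg LinearMap.det h
  rw [LinearMap.det_comp, h0, LinearMap.det_id] at this
  simp at this

lemma uL_bij (t : E →ₗ[ℂ] F) : Function.Bijective (uL t) := by
  refine Function.bijective_iff_has_inverse.2 ⟨uL (-t), fun x => ?_, fun x => ?_⟩ <;>
  · apply lp_ext <;> simp

lemma uU_bij (t : F →ₗ[ℂ] E) : Function.Bijective (uU t) := by
  refine Function.bijective_iff_has_inverse.2 ⟨uU (-t), fun x => ?_, fun x => ?_⟩ <;>
  · apply lp_ext <;> simp

lemma det_one_aux {u u' s s' : E →ₗ[ℂ] E} (hu : u ∘ₗ u' = LinearMap.id)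
    (hs : s ∘ₗ s' = LinearMap.id) (h : s ∘ₗ u = u ∘ₗ u ∘ₗ s) : u.normDet = 1 := by
  have h1 := det_ne_zero_of_comp hu
  have h2 := det_ne_zero_of_comp hs
  have h3 := congrArg LinearMap.det h
  rw [LinearMap.det_comp, LinearMap.det_comp, LinearMap.det_comp] at h3
  have h4 : LinearMap.det u = 1 := by
    have : LinearMap.det u * LinearMap.det s * (LinearMap.det u - 1) = 0 := by
      linear_combination -h3
    simpa [h1, h2, sub_eq_zero] using this
  rw [LinearMap.normDet_eq_norm_det, h4]
  simp

lemma normDet_uL (t : E →ₗ[ℂ] F) : (uL t).normDet = 1 := by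
  refine det_one_aux (u' := uL (-t)) (s := pr LinearMap.id ((2 : ℂ) • LinearMap.id))
    (s' := pr LinearMap.id ((2 : ℂ)⁻¹ • LinearMap.id)) ?_ ?_ ?_ <;>
  · ext x
    apply lp_ext <;> simp [smul_smul] <;> module

lemma normDet_uU (t : F →ₗ[ℂ] E) : (uU t).normDet = 1 := by
  refine det_one_aux (u' := uU (-t)) (s := pr ((2 : ℂ) • LinearMap.id) LinearMap.id)
    (s' := pr ((2 : ℂ)⁻¹ • LinearMap.id) LinearMap.id) ?_ ?_ ?_ <;>
  · ext x
    apply lp_ext <;> simp [smul_smul] <;> module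

/-- A bijective norm-preserving map has volume one. -/
lemma normDet_of_inner (g : E →ₗ[ℂ] F) (h : ∀ x, ‖g x‖ = ‖x‖) : g.normDet = 1 :=
  (LinearIsometry.mk g h).normDet_eq_one

end LinAlg

section Complexes

variable {n : ℕ}

open FinComplex

/-- The differential as a map to the cocycles. -/
def del (Z : FinComplex n) (q : ℕ) : Z.C q →ₗ[ℂ] LinearMap.ker (Z.d (q + 1)) :=
  (Z.d q).codRestrict _ (fun x => by
    rw [LinearMap.mem_ker]; exact LinearMap.congr_fun (Z.dd q) x)

@[simp] lemma coe_del (Z : FinComplex n) (q : ℕ) (x : Z.C q) :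
    ((del Z q x : LinearMap.ker (Z.d (q + 1))) : Z.C (q + 1)) = Z.d q x := rfl

/-- Orthogonal projection to the cocycles. -/
def P (Z : FinComplex n) (q : ℕ) : Z.C q →ₗ[ℂ] LinearMap.ker (Z.d q) :=
  (LinearMap.ker (Z.d q)).orthogonalProjectionOnto.toLinearMap

lemma P_coe (Z : FinComplex n) (q : ℕ) (x : LinearMap.ker (Z.d q)) : P Z q (x : Z.C q) = x :=
  Submodule.orthogonalProjectionOnto_mem_subspace_eq_self x

lemma P_of_d (Z : FinComplex n) (q : ℕ) (x : Z.C q) (hx : Z.d q x = 0) :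
    ((P Z q x : LinearMap.ker (Z.d q)) : Z.C q) = x := by
  have := P_coe Z q ⟨x, hx⟩
  exact congrArg Subtype.val this

lemma d_P (Z : FinComplex n) (q : ℕ) (x : Z.C q) :
    Z.d q ((P Z q x : LinearMap.ker (Z.d q)) : Z.C q) = 0 :=
  (P Z q x).2

lemma P_inner (Z : FinComplex n) (q : ℕ) (x y : Z.C q) (hy : Z.d q y = 0) :
    inner ℂ ((P Z q x : LinearMap.ker (Z.d q)) : Z.C q) y = inner ℂ x y := by
  have := Submodule.starProjection_inner_eq_zero (K := LinearMap.ker (Z.d q)) x y hy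
  rw [inner_sub_left, sub_eq_zero] at this
  exact this.symm

lemma inner_P (Z : FinComplex n) (q : ℕ) (x y : Z.C q) (hy : Z.d q y = 0) :
    inner ℂ y ((P Z q x : LinearMap.ker (Z.d q)) : Z.C q) = inner ℂ y x := by
  rw [← inner_conj_symm, P_inner Z q x y hy, inner_conj_symm]

lemma P_eq_zero (Z : FinComplex n) (q : ℕ) (x : Z.C q)
    (h : ∀ y, Z.d q y = 0 → inner ℂ x y = 0) : P Z q x = 0 := by
  apply Subtype.ext
  rw [Submodule.coe_zero, ← inner_self_eq_zero (𝕜 := ℂ), P_inner _ _ _ _ (d_P Z q x)]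
  exact h _ (d_P Z q x)

/-- The decomposition map `x ↦ (d x, P x)`. -/
def D (Z : FinComplex n) (q : ℕ) :
    Z.C q →ₗ[ℂ] WithLp 2 (LinearMap.ker (Z.d (q + 1)) × LinearMap.ker (Z.d q)) :=
  sumL (del Z q) (P Z q)

lemma del_surj (Z : FinComplex n) (hZ : Z.Acyclic) (q : ℕ) : Function.Surjective (del Z q) := by
  rintro ⟨y, hy⟩
  rw [hZ.2 q] at hy
  obtain ⟨x, rfl⟩ := hy
  exact ⟨x, rfl⟩

lemma D_bij (Z : FinComplex n) (hZ : Z.Acyclic) (q : ℕ) : Function.Bijective (D Z q) := by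
  constructor
  · rw [← LinearMap.ker_eq_bot, LinearMap.ker_eq_bot']
    intro x hx
    have h1 : del Z q x = 0 := congrArg WithLp.fst hx
    have h2 : P Z q x = 0 := congrArg WithLp.snd hx
    have h3 : Z.d q x = 0 := congrArg Subtype.val h1
    rw [← P_of_d Z q x h3, h2]; rfl
  · intro y
    obtain ⟨x, hx⟩ := del_surj Z hZ q y.fst
    refine ⟨x - (P Z q x : Z.C q) + (y.snd : Z.C q), lp_ext ?_ ?_⟩
    · apply Subtype.ext
      have h4 : Z.d q (y.snd : Z.C q) = 0 := y.snd.2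
      have h5 := congrArg Subtype.val hx
      rw [coe_del] at h5
      change Z.d q _ = _
      rw [map_add, map_sub, h4, d_P, h5]; simp
    · change P Z q _ = _
      rw [map_add, map_sub, P_coe, P_coe]; simp

/-- `d d^*` on cocycles. -/
def M (Z : FinComplex n) (q : ℕ) :
    LinearMap.ker (Z.d (q + 1)) →ₗ[ℂ] LinearMap.ker (Z.d (q + 1)) :=
  del Z q ∘ₗ LinearMap.adjoint (del Z q)

lemma adjoint_del (Z : FinComplex n) (q : ℕ) (b : LinearMap.ker (Z.d (q + 1))) :
    LinearMap.adjoint (del Z q) b = LinearMap.adjoint (Z.d q) (b : Z.C (q + 1)) := by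
  apply ext_inner_right ℂ
  intro y
  rw [LinearMap.adjoint_inner_left, LinearMap.adjoint_inner_left]
  rfl

lemma P_adj (Z : FinComplex n) (q : ℕ) (z : Z.C (q + 1)) :
    P Z q (LinearMap.adjoint (Z.d q) z) = 0 := by
  apply P_eq_zero
  intro y hy
  rw [LinearMap.adjoint_inner_left, hy, inner_zero_right]

lemma adjoint_D (Z : FinComplex n) (q : ℕ)
    (y : WithLp 2 (LinearMap.ker (Z.d (q + 1)) × LinearMap.ker (Z.d q))) :
    LinearMap.adjoint (D Z q) y = LinearMap.adjoint (del Z q) y.fst + (y.snd : Z.C q) := by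
  apply ext_inner_right ℂ
  intro z
  have hs : Z.d q (y.snd : Z.C q) = 0 := y.snd.2
  rw [LinearMap.adjoint_inner_left, inner_add_left, LinearMap.adjoint_inner_left,
    WithLp.prod_inner_apply, ← inner_P Z q z _ hs]
  rfl

lemma D_adjoint_D (Z : FinComplex n) (q : ℕ) :
    D Z q ∘ₗ LinearMap.adjoint (D Z q) = pr (M Z q) LinearMap.id := by
  apply LinearMap.ext
  intro y
  rw [LinearMap.comp_apply, adjoint_D]
  apply lp_ext
  · change del Z q _ = del Z q _
    have h4 : Z.d q (y.snd : Z.C q) = 0 := y.snd.2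
    rw [map_add]
    have : del Z q (y.snd : Z.C q) = 0 := Subtype.ext h4
    rw [this, add_zero]
    rfl
  · change P Z q _ = y.snd
    rw [map_add, adjoint_del, P_adj, P_coe, zero_add]

lemma det_M (Z : FinComplex n) (hZ : Z.Acyclic) (q : ℕ) :
    LinearMap.det (M Z q) = (((D Z q).normDet ^ 2 : ℝ) : ℂ) := by
  have h1 := (D Z q).normDet_sq
  let e := LinearEquiv.ofBijective (D Z q) (D_bij Z hZ q)
  have h2 := LinearMap.det_conj (LinearMap.adjoint (D Z q) ∘ₗ D Z q) e
  have h3 : e.toLinearMap ∘ₗ (LinearMap.adjoint (D Z q) ∘ₗ D Z q) ∘ₗ e.symm.toLinearMap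
      = D Z q ∘ₗ LinearMap.adjoint (D Z q) := by
    apply LinearMap.ext
    intro y
    obtain ⟨x, rfl⟩ := e.surjective y
    simp only [LinearMap.comp_apply, LinearEquiv.coe_coe, LinearEquiv.symm_apply_apply]
    rfl
  rw [h3, D_adjoint_D, det_pr, LinearMap.det_id, mul_one] at h2
  rw [h2]
  exact h1.symm

lemma D_lap (Z : FinComplex n) (q : ℕ) :
    D Z (q + 1) ∘ₗ Z.lap (q + 1) = pr (M Z (q + 1)) (M Z q) ∘ₗ D Z (q + 1) := by
  apply LinearMap.ext
  intro x
  rw [LinearMap.comp_apply, LinearMap.comp_apply]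
  have hl : Z.lap (q + 1) x = LinearMap.adjoint (Z.d (q + 1)) (Z.d (q + 1) x) +
      Z.d q (LinearMap.adjoint (Z.d q) x) := rfl
  have hdd : ∀ w, Z.d (q + 1) (Z.d q w) = 0 := fun w => LinearMap.congr_fun (Z.dd q) w
  rw [hl]
  apply lp_ext
  · change del Z (q + 1) _ = del Z (q + 1) (LinearMap.adjoint (del Z (q + 1)) (del Z (q + 1) x))
    rw [adjoint_del, map_add]
    have : del Z (q + 1) (Z.d q (LinearMap.adjoint (Z.d q) x)) = 0 := Subtype.ext (hdd _)
    rw [this, add_zero]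
    rfl
  · change P Z (q + 1) _ = del Z q (LinearMap.adjoint (del Z q) (P Z (q + 1) x))
    rw [map_add, P_adj, zero_add, adjoint_del]
    have : LinearMap.adjoint (Z.d q) ((P Z (q + 1) x : LinearMap.ker (Z.d (q + 1))) : Z.C (q + 1))
        = LinearMap.adjoint (Z.d q) x := by
      apply ext_inner_right ℂ
      intro y
      rw [LinearMap.adjoint_inner_left, LinearMap.adjoint_inner_left, P_inner _ _ _ _ (hdd y)]
    rw [this]
    apply Subtype.ext
    rw [P_of_d _ _ _ (hdd _)]
    rfl

/-- The log-volumes of the decomposition maps. -/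
def m (Z : FinComplex n) (q : ℕ) : ℝ := Real.log (D Z q).normDet

lemma D_pos (Z : FinComplex n) (hZ : Z.Acyclic) (q : ℕ) : 0 < (D Z q).normDet :=
  normDet_pos _ (D_bij Z hZ q).1

lemma det_lap (Z : FinComplex n) (hZ : Z.Acyclic) (q : ℕ) :
    LinearMap.det (Z.lap (q + 1)) =
      (((D Z (q + 1)).normDet ^ 2 * (D Z q).normDet ^ 2 : ℝ) : ℂ) := by
  let e := LinearEquiv.ofBijective (D Z (q + 1)) (D_bij Z hZ (q + 1))
  have h2 := LinearMap.det_conj (Z.lap (q + 1)) e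
  have h3 : e.toLinearMap ∘ₗ (Z.lap (q + 1)) ∘ₗ e.symm.toLinearMap
      = pr (M Z (q + 1)) (M Z q) := by
    apply LinearMap.ext
    intro y
    obtain ⟨x, rfl⟩ := e.surjective y
    simp only [LinearMap.comp_apply, LinearEquiv.coe_coe, LinearEquiv.symm_apply_apply]
    exact LinearMap.congr_fun (D_lap Z q) x
  rw [h3, det_pr, det_M Z hZ, det_M Z hZ] at h2
  rw [← h2]
  push_cast
  rfl

lemma log_det_lap (Z : FinComplex n) (hZ : Z.Acyclic) (q : ℕ) :
    Real.log ((LinearMap.det (Z.lap (q + 1))).re) = 2 * m Z (q + 1) + 2 * m Z q := by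
  have h1 := D_pos Z hZ q
  have h2 := D_pos Z hZ (q + 1)
  rw [det_lap Z hZ, Complex.ofReal_re, Real.log_mul (by positivity) (by positivity),
    Real.log_pow, Real.log_pow]
  simp [m]

lemma sum_aux (a : ℕ → ℝ) (N : ℕ) :
    ∑ q ∈ Finset.range N, (-1 : ℝ) ^ q * ((q : ℝ) + 1) * (a (q + 1) + a q)
      = ∑ q ∈ Finset.range N, (-1 : ℝ) ^ q * a q - (-1 : ℝ) ^ N * N * a N := by
  induction N with
  | zero => simp
  | succ k ih =>
    rw [Finset.sum_range_succ, ih, Finset.sum_range_succ]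
    push_cast
    ring

end Complexes

section Torsion

open FinComplex

variable {n : ℕ}

lemma logT_eq (Z : FinComplex n) (hZ : Z.Acyclic) :
    Z.logT = ∑ q ∈ Finset.range (n + 1), (-1 : ℝ) ^ q * m Z q := by
  have hs : Subsingleton (Z.C (n + 1)) := ⟨fun x y => by
    rw [Z.trivial_beyond (n + 1) (Nat.lt_succ_self n) x,
      Z.trivial_beyond (n + 1) (Nat.lt_succ_self n) y]⟩
  have h1 : m Z (n + 1) = 0 := by
    rw [m, LinearMap.normDet_of_subsingleton, Real.log_one]
  have h2 : Real.log ((LinearMap.det (Z.lap (n + 1))).re) = 0 := by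
    rw [LinearMap.det_eq_one_of_subsingleton]; simp
  have h3 : Z.logT = (1 / 2) * ∑ q ∈ Finset.range (n + 2),
      (-1 : ℝ) ^ (q + 1) * (q : ℝ) * Real.log ((LinearMap.det (Z.lap q)).re) := by
    rw [Finset.sum_range_succ, h2, mul_zero, add_zero]; rfl
  rw [h3, Finset.sum_range_succ']
  have h4 := sum_aux (m Z) (n + 1)
  rw [h1, mul_zero, sub_zero] at h4
  rw [← h4]
  simp only [Nat.cast_zero, mul_zero, zero_mul, add_zero]
  rw [Finset.mul_sum]
  refine Finset.sum_congr rfl fun q _ => ?_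
  rw [log_det_lap Z hZ]
  push_cast
  ring

variable {Z Z' : FinComplex n} (φ : ∀ q, Z.C q →ₗ[ℂ] Z'.C q)
  (hc : ∀ q x, φ (q + 1) (Z.d q x) = Z'.d q (φ q x))

/-- Restriction of a morphism to cocycles. -/
def resK (q : ℕ) : LinearMap.ker (Z.d q) →ₗ[ℂ] LinearMap.ker (Z'.d q) :=
  (φ q).restrict (fun x hx => by
    rw [LinearMap.mem_ker] at hx ⊢
    rw [← hc, hx, map_zero])

lemma resK_coe (q : ℕ) (x : LinearMap.ker (Z.d q)) :
    ((resK φ hc q x : LinearMap.ker (Z'.d q)) : Z'.C q) = φ q (x : Z.C q) := rfl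

lemma resK_bij (hb : ∀ q, Function.Bijective (φ q)) (q : ℕ) :
    Function.Bijective (resK φ hc q) := by
  constructor
  · intro x y h
    have := congrArg Subtype.val h
    exact Subtype.ext ((hb q).1 this)
  · rintro ⟨y, hy⟩
    obtain ⟨x, rfl⟩ := (hb q).2 y
    rw [LinearMap.mem_ker, ← hc] at hy
    have : Z.d q x = 0 := (hb (q + 1)).1 (by rw [hy, map_zero])
    exact ⟨⟨x, this⟩, rfl⟩

lemma acyclic_of_iso (hb : ∀ q, Function.Bijective (φ q)) (hZ : Z.Acyclic)
    (hc : ∀ q x, φ (q + 1) (Z.d q x) = Z'.d q (φ q x)) : Z'.Acyclic := by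
  have key : ∀ q (y : Z'.C q), Z'.d q y = 0 → ∃ x, Z.d q x = 0 ∧ φ q x = y := by
    intro q y hy
    obtain ⟨x, hx⟩ := (resK_bij φ hc hb q).2 ⟨y, hy⟩
    exact ⟨x, x.2, congrArg Subtype.val hx⟩
  constructor
  · rw [LinearMap.ker_eq_bot']
    intro y hy
    obtain ⟨x, hx, rfl⟩ := key 0 y hy
    have : x = 0 := by
      have h : x ∈ LinearMap.ker (Z.d 0) := hx
      rw [hZ.1] at h
      exact h
    rw [this, map_zero]
  · intro q
    apply le_antisymm
    · intro y hy
      obtain ⟨x, hx, rfl⟩ := key (q + 1) y hy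
      have h : x ∈ LinearMap.ker (Z.d (q + 1)) := hx
      rw [hZ.2] at h
      obtain ⟨w, rfl⟩ := h
      exact ⟨φ q w, (hc q w).symm⟩
    · rintro _ ⟨w, rfl⟩
      exact LinearMap.congr_fun (Z'.dd q) w

lemma factor (hb : ∀ q, Function.Bijective (φ q)) (hZ : Z.Acyclic) (q : ℕ) :
    ∃ t, D Z' q ∘ₗ φ q
      = uL t ∘ₗ pr (resK φ hc (q + 1)) (resK φ hc q) ∘ₗ D Z q := by
  let e := LinearEquiv.ofBijective (D Z q) (D_bij Z hZ q)
  let r := LinearEquiv.ofBijective (resK φ hc (q + 1)) (resK_bij φ hc hb (q + 1))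
  refine ⟨P Z' q ∘ₗ φ q ∘ₗ e.symm.toLinearMap ∘ₗ (sumL LinearMap.id 0) ∘ₗ r.symm.toLinearMap, ?_⟩
  apply LinearMap.ext
  intro x
  have h1 : e.symm (WithLp.toLp 2 (del Z q x, 0)) = x - (P Z q x : Z.C q) := by
    rw [LinearEquiv.symm_apply_eq]
    apply lp_ext
    · apply Subtype.ext
      change Z.d q x = Z.d q _
      rw [map_sub, d_P, sub_zero]
    · change 0 = P Z q _
      rw [map_sub, P_coe, sub_self]
  have h2 : r.symm (resK φ hc (q + 1) (del Z q x)) = del Z q x := r.symm_apply_apply _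
  apply lp_ext
  · apply Subtype.ext
    exact (hc q x).symm
  · change P Z' q (φ q x) = resK φ hc q (P Z q x) + P Z' q (φ q (e.symm (WithLp.toLp 2
      (r.symm (resK φ hc (q + 1) (del Z q x)), 0))))
    rw [h2, h1, map_sub, map_sub]
    have : P Z' q (φ q (P Z q x : Z.C q)) = resK φ hc q (P Z q x) := by
      rw [← resK_coe φ hc, P_coe]
    rw [this]
    abel

lemma pr_bij {E F E' F' : Type}
    [NormedAddCommGroup E] [InnerProductSpace ℂ E]
    [NormedAddCommGroup F] [InnerProductSpace ℂ F]
    [NormedAddCommGroup E'] [InnerProductSpace ℂ E']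
    [NormedAddCommGroup F'] [InnerProductSpace ℂ F']
    (g : E →ₗ[ℂ] E') (h : F →ₗ[ℂ] F') (hg : Function.Bijective g) (hh : Function.Bijective h) :
    Function.Bijective (pr g h) := by
  constructor
  · intro x y hxy
    have h1 : g x.fst = g y.fst := congrArg WithLp.fst hxy
    have h2 : h x.snd = h y.snd := congrArg WithLp.snd hxy
    have e1 := hg.1 h1
    have e2 := hh.1 h2
    have a : x = WithLp.toLp 2 (x.fst, x.snd) := rfl
    have b : y = WithLp.toLp 2 (y.fst, y.snd) := rfl
    rw [a, b, e1, e2]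
  · intro y
    obtain ⟨a, ha⟩ := hg.2 y.fst
    obtain ⟨b, hb⟩ := hh.2 y.snd
    refine ⟨WithLp.toLp 2 (a, b), ?_⟩
    change WithLp.toLp 2 (g a, h b) = y
    rw [ha, hb]
    rfl

lemma m_rel (hb : ∀ q, Function.Bijective (φ q)) (hZ : Z.Acyclic)
    (hv : ∀ q, (φ q).normDet = 1) (q : ℕ) :
    m Z' q = Real.log (resK φ hc (q + 1)).normDet + Real.log (resK φ hc q).normDet + m Z q := by
  obtain ⟨t, ht⟩ := factor φ hc hb hZ q
  have h := congrArg LinearMap.normDet ht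
  have hpb := pr_bij _ _ (resK_bij φ hc hb (q + 1)) (resK_bij φ hc hb q)
  rw [normDet_comp_bij _ _ (hb q), normDet_comp_bij, normDet_comp_bij _ _ (D_bij Z hZ q),
    normDet_uL, normDet_pr, hv, mul_one, one_mul] at h
  · have h1 := normDet_pos _ (resK_bij φ hc hb (q + 1)).1
    have h2 := normDet_pos _ (resK_bij φ hc hb q).1
    have h3 := D_pos Z hZ q
    rw [m, h, Real.log_mul (by positivity) (by positivity),
      Real.log_mul (by positivity) (by positivity)]
    rfl
  · exact hpb.comp (D_bij Z hZ q)

lemma tel_aux (b : ℕ → ℝ) (k : ℕ) :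
    ∑ q ∈ Finset.range k, (-1 : ℝ) ^ q * (b (q + 1) + b q) = b 0 - (-1 : ℝ) ^ k * b k := by
  induction k with
  | zero => simp
  | succ k ih => rw [Finset.sum_range_succ, ih]; ring

lemma logT_iso (hb : ∀ q, Function.Bijective (φ q)) (hZ : Z.Acyclic) (hZ' : Z'.Acyclic)
    (hc : ∀ q x, φ (q + 1) (Z.d q x) = Z'.d q (φ q x))
    (hv : ∀ q, (φ q).normDet = 1) : Z'.logT = Z.logT := by
  rw [logT_eq Z hZ, logT_eq Z' hZ', ← sub_eq_zero, ← Finset.sum_sub_distrib]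
  have hs0 : Subsingleton (LinearMap.ker (Z.d 0)) := by
    rw [hZ.1]; infer_instance
  have hs1 : Subsingleton (LinearMap.ker (Z.d (n + 1))) := ⟨fun x y => Subtype.ext (by
    rw [Z.trivial_beyond (n + 1) (Nat.lt_succ_self n) x,
      Z.trivial_beyond (n + 1) (Nat.lt_succ_self n) y])⟩
  have h := tel_aux (fun q => Real.log (resK φ hc q).normDet) (n + 1)
  rw [LinearMap.normDet_of_subsingleton, LinearMap.normDet_of_subsingleton, Real.log_one,
    mul_zero, sub_zero] at h
  rw [← h]
  refine Finset.sum_congr rfl fun q _ => ?_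
  rw [m_rel φ hc hb hZ hv q]
  ring

/-- Direct sum of complexes. -/
def dsum (Z Z' : FinComplex n) : FinComplex n where
  C q := WithLp 2 (Z.C q × Z'.C q)
  d q := pr (Z.d q) (Z'.d q)
  dd q := by
    apply LinearMap.ext
    intro x
    apply lp_ext
    · exact LinearMap.congr_fun (Z.dd q) x.fst
    · exact LinearMap.congr_fun (Z'.dd q) x.snd
  trivial_beyond q hq x := by
    apply lp_ext
    · exact Z.trivial_beyond q hq _
    · exact Z'.trivial_beyond q hq _

lemma dsum_acyclic (Z Z' : FinComplex n) : (dsum Z Z').Acyclic ↔ Z.Acyclic ∧ Z'.Acyclic := by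
  constructor
  · intro h
    refine ⟨⟨?_, fun q => le_antisymm ?_ ?_⟩, ⟨?_, fun q => le_antisymm ?_ ?_⟩⟩
    · rw [LinearMap.ker_eq_bot']
      intro x hx
      have h1 : (WithLp.toLp 2 (x, 0) : WithLp 2 (Z.C 0 × Z'.C 0)) = 0 :=
        LinearMap.ker_eq_bot'.1 h.1 (WithLp.toLp 2 (x, 0)) (lp_ext hx (map_zero (Z'.d 0)))
      exact congrArg WithLp.fst h1
    · intro x hx
      have h1 : (WithLp.toLp 2 (x, 0) : WithLp 2 (Z.C (q + 1) × Z'.C (q + 1)))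
          ∈ LinearMap.ker ((dsum Z Z').d (q + 1)) := lp_ext hx (map_zero (Z'.d (q + 1)))
      rw [h.2] at h1
      obtain ⟨w, hw⟩ := h1
      exact ⟨WithLp.fst w, congrArg WithLp.fst hw⟩
    · rintro _ ⟨w, rfl⟩
      exact LinearMap.congr_fun (Z.dd q) w
    · rw [LinearMap.ker_eq_bot']
      intro x hx
      have h1 : (WithLp.toLp 2 (0, x) : WithLp 2 (Z.C 0 × Z'.C 0)) = 0 :=
        LinearMap.ker_eq_bot'.1 h.1 (WithLp.toLp 2 (0, x)) (lp_ext (map_zero (Z.d 0)) hx)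
      exact congrArg WithLp.snd h1
    · intro x hx
      have h1 : (WithLp.toLp 2 (0, x) : WithLp 2 (Z.C (q + 1) × Z'.C (q + 1)))
          ∈ LinearMap.ker ((dsum Z Z').d (q + 1)) := lp_ext (map_zero (Z.d (q + 1))) hx
      rw [h.2] at h1
      obtain ⟨w, hw⟩ := h1
      exact ⟨WithLp.snd w, congrArg WithLp.snd hw⟩
    · rintro _ ⟨w, rfl⟩
      exact LinearMap.congr_fun (Z'.dd q) w
  · rintro ⟨h, h'⟩
    refine ⟨?_, fun q => le_antisymm ?_ ?_⟩
    · rw [LinearMap.ker_eq_bot']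
      intro x hx
      exact lp_ext (LinearMap.ker_eq_bot'.1 h.1 _ (congrArg WithLp.fst hx))
        (LinearMap.ker_eq_bot'.1 h'.1 _ (congrArg WithLp.snd hx))
    · intro x hx
      have h1 : WithLp.fst x ∈ LinearMap.ker (Z.d (q + 1)) := congrArg WithLp.fst hx
      have h2 : WithLp.snd x ∈ LinearMap.ker (Z'.d (q + 1)) := congrArg WithLp.snd hx
      rw [h.2] at h1
      rw [h'.2] at h2
      obtain ⟨a, ha⟩ := h1
      obtain ⟨b, hb⟩ := h2
      exact ⟨WithLp.toLp 2 (a, b), lp_ext ha hb⟩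
    · rintro _ ⟨w, rfl⟩
      exact LinearMap.congr_fun ((dsum Z Z').dd q) w

lemma lap_dsum (Z Z' : FinComplex n) (q : ℕ) :
    (dsum Z Z').lap (q + 1) = pr (Z.lap (q + 1)) (Z'.lap (q + 1)) := by
  change LinearMap.adjoint (pr (Z.d (q + 1)) (Z'.d (q + 1))) ∘ₗ pr (Z.d (q + 1)) (Z'.d (q + 1))
    + pr (Z.d q) (Z'.d q) ∘ₗ LinearMap.adjoint (pr (Z.d q) (Z'.d q)) = _
  rw [adjoint_pr, adjoint_pr]
  rfl

lemma logT_dsum (Z Z' : FinComplex n) (hZ : Z.Acyclic) (hZ' : Z'.Acyclic) :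
    (dsum Z Z').logT = Z.logT + Z'.logT := by
  unfold FinComplex.logT
  rw [← mul_add, ← Finset.sum_add_distrib]
  congr 1
  refine Finset.sum_congr rfl fun q _ => ?_
  cases q with
  | zero => simp
  | succ q =>
    have h : LinearMap.det ((dsum Z Z').lap (q + 1))
        = LinearMap.det (Z.lap (q + 1)) * LinearMap.det (Z'.lap (q + 1)) := by
      rw [lap_dsum]; exact det_pr _ _
    have a1 := D_pos Z hZ q
    have a2 := D_pos Z hZ (q + 1)
    have a3 := D_pos Z' hZ' q
    have a4 := D_pos Z' hZ' (q + 1)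
    rw [h, det_lap Z hZ, det_lap Z' hZ', ← Complex.ofReal_mul, Complex.ofReal_re,
      Complex.ofReal_re, Complex.ofReal_re, Real.log_mul (by positivity) (by positivity)]
    ring

/-- Spaces of the cone of the identity. -/
def KC (X : FinComplex n) : ℕ → Type
  | 0 => X.C 0
  | q + 1 => WithLp 2 (X.C q × X.C (q + 1))

instance KCn (X : FinComplex n) : ∀ q, NormedAddCommGroup (KC X q)
  | 0 => inferInstanceAs (NormedAddCommGroup (X.C 0))
  | q + 1 => inferInstanceAs (NormedAddCommGroup (WithLp 2 (X.C q × X.C (q + 1))))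

instance KCi (X : FinComplex n) : ∀ q, InnerProductSpace ℂ (KC X q)
  | 0 => inferInstanceAs (InnerProductSpace ℂ (X.C 0))
  | q + 1 => inferInstanceAs (InnerProductSpace ℂ (WithLp 2 (X.C q × X.C (q + 1))))

instance KCf (X : FinComplex n) : ∀ q, FiniteDimensional ℂ (KC X q)
  | 0 => inferInstanceAs (FiniteDimensional ℂ (X.C 0))
  | q + 1 => inferInstanceAs (FiniteDimensional ℂ (WithLp 2 (X.C q × X.C (q + 1))))

/-- Differential of the cone of minus the identity, with zero internal differential. -/
def KD (X : FinComplex n) : ∀ q, KC X q →ₗ[ℂ] KC X (q + 1)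
  | 0 => (sumL (-LinearMap.id) 0 : X.C 0 →ₗ[ℂ] WithLp 2 (X.C 0 × X.C 1))
  | q + 1 => (sumL (-p2) 0 : WithLp 2 (X.C q × X.C (q + 1)) →ₗ[ℂ]
      WithLp 2 (X.C (q + 1) × X.C (q + 2)))

/-- The cone of minus the identity, with zero internal differential. -/
def K (X : FinComplex n) : FinComplex (n + 1) where
  C := KC X
  d := KD X
  dd q := by
    cases q with
    | zero =>
      apply LinearMap.ext
      intro x
      exact lp_ext (E := X.C 1) (F := X.C 2) (neg_zero) rfl
    | succ q =>
      apply LinearMap.ext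
      intro x
      exact lp_ext (E := X.C (q + 2)) (F := X.C (q + 3)) (neg_zero) rfl
  trivial_beyond q hq x := by
    cases q with
    | zero => omega
    | succ q =>
      exact lp_ext (E := X.C q) (F := X.C (q + 1)) (X.trivial_beyond q (by omega) _)
        (X.trivial_beyond (q + 1) (by omega) _)

lemma adj_K1 {E F G : Type}
    [NormedAddCommGroup E] [InnerProductSpace ℂ E] [FiniteDimensional ℂ E]
    [NormedAddCommGroup F] [InnerProductSpace ℂ F] [FiniteDimensional ℂ F]
    [NormedAddCommGroup G] [InnerProductSpace ℂ G] [FiniteDimensional ℂ G] :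
    LinearMap.adjoint (sumL (-p2) 0 : WithLp 2 (E × F) →ₗ[ℂ] WithLp 2 (F × G))
      = sumL 0 (-p1) := by
  symm
  rw [LinearMap.eq_adjoint_iff]
  intro x y
  simp [WithLp.prod_inner_apply]

lemma adj_K0 {F G : Type}
    [NormedAddCommGroup F] [InnerProductSpace ℂ F] [FiniteDimensional ℂ F]
    [NormedAddCommGroup G] [InnerProductSpace ℂ G] [FiniteDimensional ℂ G] :
    LinearMap.adjoint (sumL (-LinearMap.id) 0 : F →ₗ[ℂ] WithLp 2 (F × G)) = -p1 := by
  symm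
  rw [LinearMap.eq_adjoint_iff]
  intro x y
  simp [WithLp.prod_inner_apply]

lemma lap_K (X : FinComplex n) (q : ℕ) : (K X).lap (q + 1) = LinearMap.id := by
  cases q with
  | zero =>
    change LinearMap.adjoint (sumL (-p2) 0 : WithLp 2 (X.C 0 × X.C 1) →ₗ[ℂ]
        WithLp 2 (X.C 1 × X.C 2)) ∘ₗ (sumL (-p2) 0 : WithLp 2 (X.C 0 × X.C 1) →ₗ[ℂ]
        WithLp 2 (X.C 1 × X.C 2))
      + (sumL (-LinearMap.id) 0 : X.C 0 →ₗ[ℂ] WithLp 2 (X.C 0 × X.C 1)) ∘ₗ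
        LinearMap.adjoint (sumL (-LinearMap.id) 0 : X.C 0 →ₗ[ℂ] WithLp 2 (X.C 0 × X.C 1))
      = (LinearMap.id : WithLp 2 (X.C 0 × X.C 1) →ₗ[ℂ] WithLp 2 (X.C 0 × X.C 1))
    rw [adj_K1, adj_K0]
    apply LinearMap.ext
    intro x
    apply lp_ext <;> simp
  | succ q =>
    change LinearMap.adjoint (sumL (-p2) 0 : WithLp 2 (X.C (q + 1) × X.C (q + 2)) →ₗ[ℂ]
        WithLp 2 (X.C (q + 2) × X.C (q + 3))) ∘ₗ (sumL (-p2) 0 :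
        WithLp 2 (X.C (q + 1) × X.C (q + 2)) →ₗ[ℂ] WithLp 2 (X.C (q + 2) × X.C (q + 3)))
      + (sumL (-p2) 0 : WithLp 2 (X.C q × X.C (q + 1)) →ₗ[ℂ]
        WithLp 2 (X.C (q + 1) × X.C (q + 2))) ∘ₗ
        LinearMap.adjoint (sumL (-p2) 0 : WithLp 2 (X.C q × X.C (q + 1)) →ₗ[ℂ]
        WithLp 2 (X.C (q + 1) × X.C (q + 2)))
      = (LinearMap.id : WithLp 2 (X.C (q + 1) × X.C (q + 2)) →ₗ[ℂ]
        WithLp 2 (X.C (q + 1) × X.C (q + 2)))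
    rw [adj_K1, adj_K1]
    apply LinearMap.ext
    intro x
    apply lp_ext <;> simp

lemma logT_K (X : FinComplex n) : (K X).logT = 0 := by
  unfold FinComplex.logT
  rw [Finset.sum_eq_zero, mul_zero]
  intro q _
  cases q with
  | zero => simp
  | succ q => rw [lap_K, LinearMap.det_id]; simp

end Torsion

section Cone

open FinComplex

variable {N : ℕ}

lemma cone_acyclic {X Y : FinComplex N} {f : ∀ q, X.C q →ₗ[ℂ] Y.C q} {Z : FinComplex (N + 1)}
    (hm : IsMorphism X Y f) (hq : InducesCohomologyIso X Y f) (hZ : ConeIso X Y f Z) :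
    Z.Acyclic := by
  obtain ⟨q1, q2, q3, q4⟩ := hq
  have compat0 : ∀ u : X.C 0, Z.d 0 (hZ.e0 u) = hZ.e 0 (WithLp.toLp 2 (f 0 u, X.d 0 u)) :=
    hZ.compat0
  have compat : ∀ q (v : Y.C q) (u : X.C (q + 1)), Z.d (q + 1) (hZ.e q (WithLp.toLp 2 (v, u))) =
      hZ.e (q + 1) (WithLp.toLp 2 (-(Y.d q v) + f (q + 1) u, X.d (q + 1) u)) := hZ.compat
  refine ⟨?_, fun q => le_antisymm ?_ ?_⟩
  · rw [LinearMap.ker_eq_bot']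
    intro z hz
    obtain ⟨u, rfl⟩ := hZ.e0.surjective z
    rw [compat0, map_eq_zero_iff _ (hZ.e 0).injective] at hz
    have h1 : f 0 u = 0 := congrArg WithLp.fst hz
    have h2 : X.d 0 u = 0 := congrArg WithLp.snd hz
    rw [q1 u h2 h1, map_zero]
  · intro z hz
    obtain ⟨y, rfl⟩ := (hZ.e q).surjective z
    obtain ⟨v, u, rfl⟩ : ∃ v u, y = WithLp.toLp 2 (v, u) := ⟨y.fst, y.snd, rfl⟩
    rw [LinearMap.mem_ker, compat, map_eq_zero_iff _ (hZ.e (q + 1)).injective] at hz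
    have h1 : -(Y.d q v) + f (q + 1) u = 0 := congrArg WithLp.fst hz
    have h2 : X.d (q + 1) u = 0 := congrArg WithLp.snd hz
    have h3 : Y.d q v = f (q + 1) u := neg_add_eq_zero.1 h1
    obtain ⟨w, rfl⟩ := q3 q u h2 ⟨v, h3⟩
    have h4 : Y.d q (v - f q w) = 0 := by rw [map_sub, h3, hm, sub_self]
    cases q with
    | zero =>
      obtain ⟨x, hx, hfx⟩ := q2 _ h4
      refine ⟨hZ.e0 (w + x), ?_⟩
      rw [compat0, map_add, map_add, hx, hfx]
      simp
    | succ q =>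
      obtain ⟨x, hx, t, ht⟩ := q4 q _ h4
      refine ⟨hZ.e q (WithLp.toLp 2 (-t, w + x)), ?_⟩
      rw [compat, map_add, map_add, hx, map_neg, ← ht]
      congr 3
      · abel
      · simp
  · rintro _ ⟨w, rfl⟩
    exact LinearMap.congr_fun (Z.dd q) w

lemma exists_contraction {n : ℕ} (Z : FinComplex n) (hZ : Z.Acyclic) :
    ∃ h : ∀ q, Z.C (q + 1) →ₗ[ℂ] Z.C q,
      ∀ q y, Z.d q (h q y) + h (q + 1) (Z.d (q + 1) y) = y := by
  let e := fun q => LinearEquiv.ofBijective (D Z q) (D_bij Z hZ q)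
  have h1 : ∀ q x, (e q).symm (WithLp.toLp 2 (del Z q x, 0)) = x - (P Z q x : Z.C q) := by
    intro q x
    rw [LinearEquiv.symm_apply_eq]
    apply lp_ext
    · apply Subtype.ext
      change Z.d q x = Z.d q _
      rw [map_sub, d_P, sub_zero]
    · change 0 = P Z q _
      rw [map_sub, P_coe, sub_self]
  refine ⟨fun q => (e q).symm.toLinearMap ∘ₗ sumL LinearMap.id 0 ∘ₗ P Z (q + 1), ?_⟩
  intro q y
  change Z.d q ((e q).symm (WithLp.toLp 2 (P Z (q + 1) y, 0))) +
    (e (q + 1)).symm (WithLp.toLp 2 (P Z (q + 2) (Z.d (q + 1) y), 0)) = y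
  have h2 : P Z (q + 2) (Z.d (q + 1) y) = del Z (q + 1) y := P_coe Z (q + 2) (del Z (q + 1) y)
  rw [h2, h1]
  obtain ⟨x, hx⟩ := del_surj Z hZ q (P Z (q + 1) y)
  rw [← hx, h1, map_sub, d_P, coe_del]
  abel

section Eta

variable {X1 X2 X3 : FinComplex N} {f1 : ∀ q, X1.C q →ₗ[ℂ] X2.C q}
  {f2 : ∀ q, X2.C q →ₗ[ℂ] X3.C q} {Z1 Z2 : FinComplex (N + 1)}
  (hZ1 : ConeIso X1 X2 f1 Z1) (hZ2 : ConeIso X2 X3 f2 Z2)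

/-- Projection of the cone to its source complex. -/
def piU : ∀ q, Z2.C q →ₗ[ℂ] X2.C q
  | 0 => hZ2.e0.symm.toLinearEquiv.toLinearMap
  | q + 1 => p2 ∘ₗ (hZ2.e q).symm.toLinearEquiv.toLinearMap

/-- Inclusion of the (shifted) target complex in the cone. -/
def inj (q : ℕ) : X2.C q →ₗ[ℂ] Z1.C (q + 1) :=
  (hZ1.e q).toLinearEquiv.toLinearMap ∘ₗ sumL LinearMap.id 0

lemma inj_apply (q : ℕ) (v : X2.C q) : inj hZ1 q v = hZ1.e q (WithLp.toLp 2 (v, 0)) := rfl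

lemma piU_zero (u : X2.C 0) : piU hZ2 0 (hZ2.e0 u) = u := hZ2.e0.symm_apply_apply u

lemma piU_succ (q : ℕ) (v : X3.C q) (u : X2.C (q + 1)) :
    piU hZ2 (q + 1) (hZ2.e q (WithLp.toLp 2 (v, u))) = u := by
  change ((hZ2.e q).symm (hZ2.e q (WithLp.toLp 2 (v, u)))).snd = u
  rw [LinearIsometryEquiv.symm_apply_apply]
  rfl

lemma d_inj (q : ℕ) (v : X2.C q) : Z1.d (q + 1) (inj hZ1 q v) = -inj hZ1 (q + 1) (X2.d q v) := by
  rw [inj_apply]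
  refine (hZ1.compat q v 0).trans ?_
  have h : -inj hZ1 (q + 1) (X2.d q v) = inj hZ1 (q + 1) (-(X2.d q v)) :=
    (map_neg (inj hZ1 (q + 1)) _).symm
  rw [map_zero, map_zero, add_zero, h, inj_apply]
  rfl

lemma piU_d (q : ℕ) (z : Z2.C q) : piU hZ2 (q + 1) (Z2.d q z) = X2.d q (piU hZ2 q z) := by
  cases q with
  | zero =>
    obtain ⟨u, rfl⟩ := hZ2.e0.surjective z
    rw [piU_zero, hZ2.compat0]
    exact piU_succ hZ2 0 _ _
  | succ q =>
    obtain ⟨y, rfl⟩ := (hZ2.e q).surjective z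
    obtain ⟨v, u, rfl⟩ : ∃ v u, y = WithLp.toLp 2 (v, u) := ⟨y.fst, y.snd, rfl⟩
    rw [piU_succ]
    have := hZ2.compat q v u
    change Z2.d (q + 1) (hZ2.e q (WithLp.toLp 2 (v, u))) = _ at this
    rw [this]
    exact piU_succ hZ2 (q + 1) _ _

lemma exists_eta (hA : Z1.Acyclic) : ∃ η : ∀ q, Z2.C q →ₗ[ℂ] Z1.C q, ∀ q y,
    Z1.d q (η q y) - inj hZ1 q (piU hZ2 q y) = η (q + 1) (Z2.d q y) := by
  obtain ⟨h, hh⟩ := exists_contraction Z1 hA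
  refine ⟨fun q => h q ∘ₗ inj hZ1 q ∘ₗ piU hZ2 q, ?_⟩
  intro q y
  have := hh q (inj hZ1 q (piU hZ2 q y))
  rw [d_inj, map_neg] at this
  simp only [LinearMap.comp_apply, piU_d]
  rw [sub_eq_iff_eq_add]
  nth_rewrite 2 [← this]
  abel

end Eta

section Theta

/-- Middle swap. -/
def swp (A B C D : Type) [NormedAddCommGroup A] [InnerProductSpace ℂ A]
    [NormedAddCommGroup B] [InnerProductSpace ℂ B]
    [NormedAddCommGroup C] [InnerProductSpace ℂ C]
    [NormedAddCommGroup D] [InnerProductSpace ℂ D] :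
    WithLp 2 (WithLp 2 (A × B) × WithLp 2 (C × D)) →ₗ[ℂ]
      WithLp 2 (WithLp 2 (C × B) × WithLp 2 (A × D)) :=
  sumL (sumL (p1 ∘ₗ p2) (p2 ∘ₗ p1)) (sumL (p1 ∘ₗ p1) (p2 ∘ₗ p2))

lemma swp_norm {A B C D : Type} [NormedAddCommGroup A] [InnerProductSpace ℂ A]
    [NormedAddCommGroup B] [InnerProductSpace ℂ B]
    [NormedAddCommGroup C] [InnerProductSpace ℂ C]
    [NormedAddCommGroup D] [InnerProductSpace ℂ D]
    (x : WithLp 2 (WithLp 2 (A × B) × WithLp 2 (C × D))) : ‖swp A B C D x‖ = ‖x‖ := by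
  rw [← sq_eq_sq₀ (norm_nonneg _) (norm_nonneg _)]
  simp only [WithLp.prod_norm_sq_eq_of_L2]
  change (‖x.snd.fst‖ ^ 2 + ‖x.fst.snd‖ ^ 2) + (‖x.fst.fst‖ ^ 2 + ‖x.snd.snd‖ ^ 2) = _
  ring

lemma swp_bij {A B C D : Type} [NormedAddCommGroup A] [InnerProductSpace ℂ A]
    [NormedAddCommGroup B] [InnerProductSpace ℂ B]
    [NormedAddCommGroup C] [InnerProductSpace ℂ C]
    [NormedAddCommGroup D] [InnerProductSpace ℂ D] : Function.Bijective (swp A B C D) :=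
  Function.bijective_iff_has_inverse.2 ⟨swp C B A D, fun _ => rfl, fun _ => rfl⟩

variable {X1 X2 X3 : FinComplex N} {f1 : ∀ q, X1.C q →ₗ[ℂ] X2.C q}
  {f2 : ∀ q, X2.C q →ₗ[ℂ] X3.C q} {Z1 Z2 Z3 : FinComplex (N + 1)}
  (hZ1 : ConeIso X1 X2 f1 Z1) (hZ2 : ConeIso X2 X3 f2 Z2)
  (hZ3 : ConeIso X1 X3 (fun q => (f2 q).comp (f1 q)) Z3)

/-- The degree-zero comparison map. -/
def Th0 : WithLp 2 (Z1.C 0 × Z2.C 0) →ₗ[ℂ] WithLp 2 (Z3.C 0 × X2.C 0) :=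
  pr hZ3.e0.toLinearEquiv.toLinearMap LinearMap.id ∘ₗ uL (-f1 0) ∘ₗ
    pr hZ1.e0.symm.toLinearEquiv.toLinearMap hZ2.e0.symm.toLinearEquiv.toLinearMap

/-- The comparison map in positive degrees. -/
def Th1 (q : ℕ) : WithLp 2 (Z1.C (q + 1) × Z2.C (q + 1)) →ₗ[ℂ]
    WithLp 2 (Z3.C (q + 1) × WithLp 2 (X2.C q × X2.C (q + 1))) :=
  pr (hZ3.e q).toLinearEquiv.toLinearMap LinearMap.id ∘ₗ
    swp (X2.C q) (X1.C (q + 1)) (X3.C q) (X2.C (q + 1)) ∘ₗ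
    uL (sumL (f2 q ∘ₗ p1) (X2.d q ∘ₗ p1 - f1 (q + 1) ∘ₗ p2)) ∘ₗ
    pr (hZ1.e q).symm.toLinearEquiv.toLinearMap (hZ2.e q).symm.toLinearEquiv.toLinearMap

lemma Th0_bij : Function.Bijective (Th0 hZ1 hZ2 hZ3) :=
  (pr_bij _ _ hZ3.e0.bijective Function.bijective_id).comp
    ((uL_bij _).comp (pr_bij _ _ hZ1.e0.symm.bijective hZ2.e0.symm.bijective))

lemma Th1_bij (q : ℕ) : Function.Bijective (Th1 hZ1 hZ2 hZ3 q) :=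
  (pr_bij _ _ (hZ3.e q).bijective Function.bijective_id).comp
    (swp_bij.comp ((uL_bij _).comp
      (pr_bij _ _ (hZ1.e q).symm.bijective (hZ2.e q).symm.bijective)))

lemma Th0_vol : (Th0 hZ1 hZ2 hZ3).normDet = 1 := by
  have b1 := pr_bij _ _ hZ1.e0.symm.bijective hZ2.e0.symm.bijective
  unfold Th0
  rw [normDet_comp_bij _ _ ((uL_bij _).comp b1), normDet_comp_bij _ _ b1, normDet_uL,
    normDet_pr, normDet_pr, normDet_isom, normDet_isom, normDet_isom, LinearMap.normDet_id]
  norm_num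

lemma Th1_vol (q : ℕ) : (Th1 hZ1 hZ2 hZ3 q).normDet = 1 := by
  have b1 := pr_bij _ _ (hZ1.e q).symm.bijective (hZ2.e q).symm.bijective
  unfold Th1
  rw [normDet_comp_bij _ _ (swp_bij.comp ((uL_bij _).comp b1)),
    normDet_comp_bij _ _ ((uL_bij _).comp b1), normDet_comp_bij _ _ b1, normDet_uL,
    normDet_pr, normDet_pr, normDet_isom, normDet_isom, normDet_isom, LinearMap.normDet_id,
    normDet_of_inner _ swp_norm]
  norm_num

lemma Th0_apply (u1 : X1.C 0) (u2 : X2.C 0) :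
    Th0 hZ1 hZ2 hZ3 (WithLp.toLp 2 (hZ1.e0 u1, hZ2.e0 u2))
      = WithLp.toLp 2 (hZ3.e0 u1, u2 - f1 0 u1) := by
  apply lp_ext <;> simp [Th0, sub_eq_add_neg]

lemma Th1_apply (q : ℕ) (v2 : X2.C q) (u1 : X1.C (q + 1)) (v3 : X3.C q) (u2 : X2.C (q + 1)) :
    Th1 hZ1 hZ2 hZ3 q (WithLp.toLp 2 (hZ1.e q (WithLp.toLp 2 (v2, u1)),
        hZ2.e q (WithLp.toLp 2 (v3, u2))))
      = WithLp.toLp 2 (hZ3.e q (WithLp.toLp 2 (v3 + f2 q v2, u1)),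
          WithLp.toLp 2 (v2, u2 + (X2.d q v2 - f1 (q + 1) u1))) := by
  apply lp_ext <;> simp [Th1, swp]

lemma chain0 (hm1 : IsMorphism X1 X2 f1) (x : Z1.C 0) (y : Z2.C 0) :
    Th1 hZ1 hZ2 hZ3 0 (WithLp.toLp 2 (Z1.d 0 x - inj hZ1 0 (piU hZ2 0 y), Z2.d 0 y))
      = pr (Z3.d 0) (sumL (-LinearMap.id) 0) (Th0 hZ1 hZ2 hZ3 (WithLp.toLp 2 (x, y))) := by
  obtain ⟨u1, rfl⟩ := hZ1.e0.surjective x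
  obtain ⟨u2, rfl⟩ := hZ2.e0.surjective y
  have c1 : Z1.d 0 (hZ1.e0 u1) = hZ1.e 0 (WithLp.toLp 2 (f1 0 u1, X1.d 0 u1)) := hZ1.compat0 u1
  have c2 : Z2.d 0 (hZ2.e0 u2) = hZ2.e 0 (WithLp.toLp 2 (f2 0 u2, X2.d 0 u2)) := hZ2.compat0 u2
  have c3 : Z3.d 0 (hZ3.e0 u1) = hZ3.e 0 (WithLp.toLp 2 (f2 0 (f1 0 u1), X1.d 0 u1)) :=
    hZ3.compat0 u1
  rw [piU_zero, inj_apply, c1, c2, ← map_sub, ← WithLp.toLp_sub, Prod.mk_sub_mk, sub_zero,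
    Th1_apply, Th0_apply]
  change _ = WithLp.toLp 2 (Z3.d 0 (hZ3.e0 u1), WithLp.toLp 2 (-(u2 - f1 0 u1), 0))
  have e1 : f2 0 u2 + f2 0 (f1 0 u1 - u2) = f2 0 (f1 0 u1) := by rw [map_sub]; abel
  have e2 : f1 0 u1 - u2 = -(u2 - f1 0 u1) := by abel
  have e3 : X2.d 0 u2 + (X2.d 0 (f1 0 u1 - u2) - f1 (0 + 1) (X1.d 0 u1)) = 0 := by
    rw [map_sub, hm1]; abel
  rw [c3, e1, e3, e2]

lemma chain1 (hm1 : IsMorphism X1 X2 f1) (hm2 : IsMorphism X2 X3 f2) (q : ℕ)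
    (x : Z1.C (q + 1)) (y : Z2.C (q + 1)) :
    Th1 hZ1 hZ2 hZ3 (q + 1) (WithLp.toLp 2 (Z1.d (q + 1) x - inj hZ1 (q + 1) (piU hZ2 (q + 1) y),
        Z2.d (q + 1) y))
      = pr (Z3.d (q + 1)) (sumL (-p2) 0) (Th1 hZ1 hZ2 hZ3 q (WithLp.toLp 2 (x, y))) := by
  obtain ⟨x, rfl⟩ := (hZ1.e q).surjective x
  obtain ⟨v2, u1, rfl⟩ : ∃ v u, x = WithLp.toLp 2 (v, u) := ⟨x.fst, x.snd, rfl⟩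
  obtain ⟨y, rfl⟩ := (hZ2.e q).surjective y
  obtain ⟨v3, u2, rfl⟩ : ∃ v u, y = WithLp.toLp 2 (v, u) := ⟨y.fst, y.snd, rfl⟩
  have c1 : Z1.d (q + 1) (hZ1.e q (WithLp.toLp 2 (v2, u1))) = hZ1.e (q + 1)
      (WithLp.toLp 2 (-(X2.d q v2) + f1 (q + 1) u1, X1.d (q + 1) u1)) := hZ1.compat q v2 u1
  have c2 : Z2.d (q + 1) (hZ2.e q (WithLp.toLp 2 (v3, u2))) = hZ2.e (q + 1)
      (WithLp.toLp 2 (-(X3.d q v3) + f2 (q + 1) u2, X2.d (q + 1) u2)) := hZ2.compat q v3 u2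
  have c3 : ∀ v u, Z3.d (q + 1) (hZ3.e q (WithLp.toLp 2 (v, u))) = hZ3.e (q + 1)
      (WithLp.toLp 2 (-(X3.d q v) + f2 (q + 1) (f1 (q + 1) u), X1.d (q + 1) u)) :=
    fun v u => hZ3.compat q v u
  have hdd : X2.d (q + 1) (X2.d q v2) = 0 := LinearMap.congr_fun (X2.dd q) v2
  rw [piU_succ, inj_apply, c1, c2, ← map_sub, ← WithLp.toLp_sub, Prod.mk_sub_mk, sub_zero,
    Th1_apply, Th1_apply]
  change _ = WithLp.toLp 2 (Z3.d (q + 1) (hZ3.e q (WithLp.toLp 2 (v3 + f2 q v2, u1))),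
    WithLp.toLp 2 (-(u2 + (X2.d q v2 - f1 (q + 1) u1)), 0))
  have e1 : -(X3.d q v3) + f2 (q + 1) u2 + f2 (q + 1) (-(X2.d q v2) + f1 (q + 1) u1 - u2)
      = -(X3.d q (v3 + f2 q v2)) + f2 (q + 1) (f1 (q + 1) u1) := by
    rw [map_sub, map_add, map_add, map_neg, hm2]; abel
  have e2 : -(X2.d q v2) + f1 (q + 1) u1 - u2 = -(u2 + (X2.d q v2 - f1 (q + 1) u1)) := by abel
  have e3 : X2.d (q + 1) u2 + (X2.d (q + 1) (-(X2.d q v2) + f1 (q + 1) u1 - u2)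
      - f1 (q + 1 + 1) (X1.d (q + 1) u1)) = 0 := by
    rw [map_sub, map_add, map_neg, hdd, hm1]; abel
  rw [c3, e1, e3, e2]

/-- The comparison map. -/
def Th : ∀ q, (dsum Z1 Z2).C q →ₗ[ℂ] (dsum Z3 (K X2)).C q
  | 0 => Th0 hZ1 hZ2 hZ3
  | q + 1 => Th1 hZ1 hZ2 hZ3 q

lemma Th_bij : ∀ q, Function.Bijective (Th hZ1 hZ2 hZ3 q)
  | 0 => Th0_bij hZ1 hZ2 hZ3
  | q + 1 => Th1_bij hZ1 hZ2 hZ3 q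

lemma Th_vol : ∀ q, (Th hZ1 hZ2 hZ3 q).normDet = 1
  | 0 => Th0_vol hZ1 hZ2 hZ3
  | q + 1 => Th1_vol hZ1 hZ2 hZ3 q

lemma Th_chain (hm1 : IsMorphism X1 X2 f1) (hm2 : IsMorphism X2 X3 f2) :
    ∀ q (x : Z1.C q) (y : Z2.C q),
    Th hZ1 hZ2 hZ3 (q + 1) (WithLp.toLp 2 (Z1.d q x - inj hZ1 q (piU hZ2 q y), Z2.d q y))
      = (dsum Z3 (K X2)).d q (Th hZ1 hZ2 hZ3 q (WithLp.toLp 2 (x, y)))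
  | 0 => chain0 hZ1 hZ2 hZ3 hm1
  | q + 1 => chain1 hZ1 hZ2 hZ3 hm1 hm2 q

end Theta

lemma main_aux {X1 X2 X3 : FinComplex N} {f1 : ∀ q, X1.C q →ₗ[ℂ] X2.C q}
    {f2 : ∀ q, X2.C q →ₗ[ℂ] X3.C q} {Z1 Z2 Z3 : FinComplex (N + 1)}
    (hZ1 : ConeIso X1 X2 f1 Z1) (hZ2 : ConeIso X2 X3 f2 Z2)
    (hZ3 : ConeIso X1 X3 (fun q => (f2 q).comp (f1 q)) Z3)
    (hm1 : IsMorphism X1 X2 f1) (hm2 : IsMorphism X2 X3 f2)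
    (hA1 : Z1.Acyclic) (hA2 : Z2.Acyclic) :
    Z3.Acyclic ∧ Z3.logT = Z1.logT + Z2.logT := by
  obtain ⟨η, hη⟩ := exists_eta hZ1 hZ2 hA1
  let Φ : ∀ q, (dsum Z1 Z2).C q →ₗ[ℂ] (dsum Z3 (K X2)).C q :=
    fun q => Th hZ1 hZ2 hZ3 q ∘ₗ (uU (η q) : WithLp 2 (Z1.C q × Z2.C q) →ₗ[ℂ] _)
  have hb : ∀ q, Function.Bijective (Φ q) := fun q => (Th_bij hZ1 hZ2 hZ3 q).comp (uU_bij (η q))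
  have hv : ∀ q, (Φ q).normDet = 1 := by
    intro q
    have h := normDet_comp_bij (Th hZ1 hZ2 hZ3 q) (uU (η q)) (uU_bij (η q))
    have h2 : (uU (η q)).normDet = 1 := normDet_uU (η q)
    have h3 := Th_vol hZ1 hZ2 hZ3 q
    refine h.trans ((congrArg₂ (· * ·) h3 h2).trans (mul_one 1))
  have hc : ∀ q x, Φ (q + 1) ((dsum Z1 Z2).d q x) = (dsum Z3 (K X2)).d q (Φ q x) := by
    intro q x
    obtain ⟨a, b, rfl⟩ : ∃ a b, x = WithLp.toLp 2 (a, b) := ⟨WithLp.fst x, WithLp.snd x, rfl⟩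
    refine Eq.trans ?_ (Th_chain hZ1 hZ2 hZ3 hm1 hm2 q (a + η q b) b)
    change Th hZ1 hZ2 hZ3 (q + 1) (WithLp.toLp 2 (Z1.d q a + η (q + 1) (Z2.d q b), Z2.d q b)) = _
    rw [← hη, map_add, add_sub_assoc]
  have hS : (dsum Z1 Z2).Acyclic := (dsum_acyclic Z1 Z2).2 ⟨hA1, hA2⟩
  have hS' : (dsum Z3 (K X2)).Acyclic := acyclic_of_iso Φ hb hS hc
  have hA3 := (dsum_acyclic Z3 (K X2)).1 hS'
  refine ⟨hA3.1, ?_⟩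
  have h := logT_iso Φ hb hS hS' hc hv
  rw [logT_dsum _ _ hA1 hA2, logT_dsum _ _ hA3.1 hA3.2, logT_K, add_zero] at h
  exact h

end Cone


end TC

open FinComplex in
/-- **Proposition 1.15 of [BFK, "Relative torsion"]** (finite-dimensional case `𝒜 = ℂ`).
If `f₁ : C¹ → C²` and `f₂ : C² → C³` are morphisms of cochain complexes of
finite-dimensional complex inner product spaces, each inducing an isomorphism in
cohomology, then the mapping cones `C(f₁)`, `C(f₂)`, `C(f₂ ∘ f₁)` are acyclic and
`log T(C(f₂ ∘ f₁)) = log T(C(f₁)) + log T(C(f₂))`. -/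
theorem torsion_cone_comp (N : ℕ) (X1 X2 X3 : FinComplex N)
    (f1 : ∀ q, X1.C q →ₗ[ℂ] X2.C q) (f2 : ∀ q, X2.C q →ₗ[ℂ] X3.C q)
    (hm1 : IsMorphism X1 X2 f1) (hm2 : IsMorphism X2 X3 f2)
    (hq1 : InducesCohomologyIso X1 X2 f1) (hq2 : InducesCohomologyIso X2 X3 f2)
    (Z1 Z2 Z3 : FinComplex (N + 1))
    (hZ1 : ConeIso X1 X2 f1 Z1) (hZ2 : ConeIso X2 X3 f2 Z2)
    (hZ3 : ConeIso X1 X3 (fun q => (f2 q).comp (f1 q)) Z3) :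
    Z1.Acyclic ∧ Z2.Acyclic ∧ Z3.Acyclic ∧ Z3.logT = Z1.logT + Z2.logT := by
  have hA1 := TC.cone_acyclic hm1 hq1 hZ1
  have hA2 := TC.cone_acyclic hm2 hq2 hZ2
  obtain ⟨hA3, h⟩ := TC.main_aux hZ1 hZ2 hZ3 hm1 hm2 hA1 hA2
  exact ⟨hA1, hA2, hA3, h⟩
end
end
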